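/- arXiv:1707.08329 — 7 statements merged into one kernel-verified Lean document; each statement's English description precedes it below -/
import Mathlib

section
/- Let ε ∈ {0,1}, let α ∈ ℂ with Re α > −1, and let κ ∈ ℤ. Then ∫_{−π}^{π} e^{iκθ}·sgn(sin θ)^ε·|sin θ|^α dθ = σ(κ,ε)·2^{1−α}·π·Γ(1+α)/(Γ(1+α/2+κ/2)·Γ(1+α/2−κ/2)), where σ(κ,ε) = (1−ε)·cos(κπ/2) + i·ε·sin(κπ/2). -/
open MeasureTheory

/-- The integral of `e^{iκθ} (sin θ)^α` over `[0, π]`. -/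
noncomputable def sinCpowIntegral (α : ℂ) (κ : ℤ) : ℂ :=
  ∫ θ in (0 : ℝ)..Real.pi,
    Complex.exp ((κ : ℂ) * (θ : ℂ) * Complex.I) * ((Real.sin θ : ℝ) : ℂ) ^ α

/-- The half-angle substitution `x = (1 - cos θ) / 2` maps `(0, π)` onto `(0, 1)`. -/
lemma image_one_sub_cos_div_two_Ioo :
    (fun θ : ℝ => (1 - Real.cos θ) / 2) '' Set.Ioo 0 Real.pi = Set.Ioo 0 1 := by
  ext x
  simp only [Set.mem_image, Set.mem_Ioo]
  constructor
  · rintro ⟨θ, ⟨h0, h1⟩, rfl⟩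
    have hs := Real.sin_pos_of_pos_of_lt_pi h0 h1
    have := Real.sin_sq_add_cos_sq θ
    constructor <;> nlinarith [sq_nonneg (Real.cos θ - 1), sq_nonneg (Real.cos θ + 1)]
  · rintro ⟨h0, h1⟩
    refine ⟨Real.arccos (1 - 2 * x), ⟨Real.arccos_pos.2 (by linarith), ?_⟩, ?_⟩
    · refine lt_of_le_of_ne (Real.arccos_le_pi _) fun h => ?_
      have := Real.arccos_eq_pi.1 h
      linarith
    · rw [Real.cos_arccos (by linarith) (by linarith)]
      ring

lemma hasDerivAt_one_sub_cos_div_two (θ : ℝ) :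
    HasDerivAt (fun θ : ℝ => (1 - Real.cos θ) / 2) (Real.sin θ / 2) θ := by
  simpa using ((Real.hasDerivAt_cos θ).const_sub 1).div_const 2

lemma monotoneOn_one_sub_cos_div_two :
    MonotoneOn (fun θ : ℝ => (1 - Real.cos θ) / 2) (Set.Ioo 0 Real.pi) := by
  intro a ha b hb hab
  have := Real.cos_le_cos_of_nonneg_of_le_pi ha.1.le hb.2.le hab
  simp only
  linarith

/-- The transformed symmetric beta integrand is a multiple of a power of the sine. -/
lemma beta_integrand_half_angle (α : ℂ) {θ : ℝ} (hθ : θ ∈ Set.Ioo 0 Real.pi) :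
    (Real.sin θ / 2) • ((((1 - Real.cos θ) / 2 : ℝ) : ℂ) ^ ((α + 1) / 2 - 1) *
      (1 - (((1 - Real.cos θ) / 2 : ℝ) : ℂ)) ^ ((α + 1) / 2 - 1)) =
      (2 : ℂ) ^ (-α) * ((Real.sin θ : ℝ) : ℂ) ^ α := by
  have hs := Real.sin_pos_of_pos_of_lt_pi hθ.1 hθ.2
  have hx : 0 ≤ (1 - Real.cos θ) / 2 := by linarith [Real.cos_le_one θ]
  have hy : 0 ≤ (1 + Real.cos θ) / 2 := by linarith [Real.neg_one_le_cos θ]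
  have h2 : (0 : ℝ) ≤ Real.sin θ / 2 := by positivity
  have hne : ((Real.sin θ / 2 : ℝ) : ℂ) ≠ 0 := by
    exact_mod_cast (by positivity : Real.sin θ / 2 ≠ 0)
  have e1 : (1 - (((1 - Real.cos θ) / 2 : ℝ) : ℂ)) = (((1 + Real.cos θ) / 2 : ℝ) : ℂ) := by
    push_cast; ring
  have e2 : (((1 - Real.cos θ) / 2 : ℝ) : ℂ) * (((1 + Real.cos θ) / 2 : ℝ) : ℂ) =
      ((Real.sin θ / 2 : ℝ) : ℂ) * ((Real.sin θ / 2 : ℝ) : ℂ) := by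
    norm_cast
    nlinarith [Real.sin_sq_add_cos_sq θ]
  have e3 : ((Real.sin θ : ℝ) : ℂ) = ((2 : ℝ) : ℂ) * ((Real.sin θ / 2 : ℝ) : ℂ) := by
    push_cast; ring
  have e4 : (2 : ℂ) ^ (-α) * 2 ^ α = 1 := by
    rw [← Complex.cpow_add _ _ two_ne_zero]; simp
  rw [e1, ← Complex.mul_cpow_ofReal_nonneg hx hy, e2, Complex.mul_cpow_ofReal_nonneg h2 h2, e3,
    Complex.mul_cpow_ofReal_nonneg two_pos.le h2, Complex.ofReal_ofNat, ← mul_assoc, e4, one_mul,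
    Complex.real_smul]
  nth_rewrite 1 [← Complex.cpow_one ((Real.sin θ / 2 : ℝ) : ℂ)]
  rw [← Complex.cpow_add _ _ hne, ← Complex.cpow_add _ _ hne]
  congr 1
  ring

lemma intervalIntegrable_sin_cpow {α : ℂ} (hα : -1 < α.re) :
    IntervalIntegrable (fun θ : ℝ => ((Real.sin θ : ℝ) : ℂ) ^ α) volume 0 Real.pi := by
  have hs : 0 < ((α + 1) / 2).re := by
    simp; linarith
  have h := Complex.betaIntegral_convergent hs hs
  rw [intervalIntegrable_iff_integrableOn_Ioo_of_le zero_le_one,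
    ← image_one_sub_cos_div_two_Ioo,
    integrableOn_image_iff_integrableOn_deriv_smul_of_monotoneOn measurableSet_Ioo
      (fun x _ => (hasDerivAt_one_sub_cos_div_two x).hasDerivWithinAt)
      monotoneOn_one_sub_cos_div_two,
    integrableOn_congr_fun (fun θ hθ => beta_integrand_half_angle α hθ) measurableSet_Ioo] at h
  rw [intervalIntegrable_iff_integrableOn_Ioo_of_le Real.pi_pos.le]
  refine IntegrableOn.congr_fun (h.const_mul ((2 : ℂ) ^ α)) (fun θ _ => ?_) measurableSet_Ioo
  rw [← mul_assoc, ← Complex.cpow_add _ _ two_ne_zero]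
  simp

lemma intervalIntegrable_exp_mul_sin_cpow {α : ℂ} (hα : -1 < α.re) (κ : ℤ) :
    IntervalIntegrable (fun θ : ℝ => Complex.exp ((κ : ℂ) * (θ : ℂ) * Complex.I) *
      ((Real.sin θ : ℝ) : ℂ) ^ α) volume 0 Real.pi :=
  (intervalIntegrable_sin_cpow hα).continuousOn_mul (by fun_prop)

lemma betaIntegral_eq_sinCpowIntegral (α : ℂ) :
    Complex.betaIntegral ((α + 1) / 2) ((α + 1) / 2) = 2 ^ (-α) * sinCpowIntegral α 0 := by
  rw [Complex.betaIntegral, intervalIntegral.integral_of_le zero_le_one,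
    integral_Ioc_eq_integral_Ioo, ← image_one_sub_cos_div_two_Ioo,
    integral_image_eq_integral_deriv_smul_of_monotoneOn measurableSet_Ioo
      (fun x _ => (hasDerivAt_one_sub_cos_div_two x).hasDerivWithinAt)
      monotoneOn_one_sub_cos_div_two,
    setIntegral_congr_fun measurableSet_Ioo (fun θ hθ => beta_integrand_half_angle α hθ),
    integral_const_mul, sinCpowIntegral, intervalIntegral.integral_of_le Real.pi_pos.le,
    integral_Ioc_eq_integral_Ioo]
  simp

/-- Integration by parts relates the frequencies `κ` and `κ + 2`. -/
lemma sinCpowIntegral_add_two {α : ℂ} (hα : -1 < α.re) (κ : ℤ) :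
    (α + 2 + κ) * sinCpowIntegral α (κ + 2) = (κ - α) * sinCpowIntegral α κ := by
  have hα' : 0 < (α + 1).re := by simp; linarith
  have hint := ((intervalIntegrable_exp_mul_sin_cpow hα (κ + 2)).const_mul
    ((α + 2 + κ) / 2)).sub ((intervalIntegrable_exp_mul_sin_cpow hα κ).const_mul ((κ - α) / 2))
  have hcont : ContinuousOn (fun θ : ℝ =>
      Complex.exp (((κ : ℂ) + 1) * (θ : ℂ) * Complex.I) * ((Real.sin θ : ℝ) : ℂ) ^ (α + 1))
      (Set.Icc 0 Real.pi) := by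
    apply Continuous.continuousOn
    exact (by fun_prop : Continuous fun θ : ℝ =>
      Complex.exp (((κ : ℂ) + 1) * (θ : ℂ) * Complex.I)).mul
      ((Complex.continuous_ofReal_cpow_const hα').comp Real.continuous_sin)
  have key := intervalIntegral.integral_eq_sub_of_hasDerivAt_of_le Real.pi_pos.le hcont
    (fun θ hθ => ?_) hint
  · rw [intervalIntegral.integral_sub
      ((intervalIntegrable_exp_mul_sin_cpow hα (κ + 2)).const_mul _)
      ((intervalIntegrable_exp_mul_sin_cpow hα κ).const_mul _),
      intervalIntegral.integral_const_mul, intervalIntegral.integral_const_mul] at key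
    have hne : α + 1 ≠ 0 := fun h => by simp [h] at hα'
    simp only [Real.sin_pi, Real.sin_zero, Complex.ofReal_zero, Complex.zero_cpow hne, mul_zero,
      sub_zero] at key
    simp only [sinCpowIntegral]
    linear_combination 2 * key
  · have hs := Real.sin_pos_of_pos_of_lt_pi hθ.1 hθ.2
    have hne : ((Real.sin θ : ℝ) : ℂ) ≠ 0 := by exact_mod_cast hs.ne'
    have h1 : HasDerivAt (fun θ : ℝ => ((Real.sin θ : ℝ) : ℂ) ^ (α + 1))
        ((α + 1) * ((Real.sin θ : ℝ) : ℂ) ^ α * ((Real.cos θ : ℝ) : ℂ)) θ := by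
      have hp : HasDerivAt (fun z : ℂ => z ^ (α + 1))
          ((α + 1) * ((Real.sin θ : ℝ) : ℂ) ^ α) ((Real.sin θ : ℝ) : ℂ) := by
        simpa using (hasDerivAt_id ((Real.sin θ : ℝ) : ℂ)).cpow_const (c := α + 1)
          (Complex.ofReal_mem_slitPlane.2 hs)
      exact hp.comp θ (Real.hasDerivAt_sin θ).ofReal_comp
    have h2 : HasDerivAt (fun θ : ℝ => Complex.exp (((κ : ℂ) + 1) * (θ : ℂ) * Complex.I))
        (Complex.exp (((κ : ℂ) + 1) * (θ : ℂ) * Complex.I) * (((κ : ℂ) + 1) * Complex.I)) θ := by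
      simpa using (((hasDerivAt_id θ).ofReal_comp.const_mul ((κ : ℂ) + 1)).mul_const
        Complex.I).cexp
    refine (h2.mul h1).congr_deriv ?_
    have ea : Complex.exp (((κ + 2 : ℤ) : ℂ) * θ * Complex.I) =
        Complex.exp (((κ : ℂ) + 1) * θ * Complex.I) * Complex.exp (θ * Complex.I) := by
      rw [← Complex.exp_add]; push_cast; congr 1; ring
    have eb : Complex.exp ((κ : ℂ) * θ * Complex.I) =
        Complex.exp (((κ : ℂ) + 1) * θ * Complex.I) * Complex.exp (-θ * Complex.I) := by
      rw [← Complex.exp_add]; congr 1; ring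
    rw [ea, eb, Complex.cpow_add _ _ hne, Complex.cpow_one, Complex.exp_mul_I θ,
      Complex.exp_mul_I (-θ), Complex.cos_neg, Complex.sin_neg]
    push_cast
    ring

lemma exp_int_mul_pi_mul_I (κ : ℤ) :
    Complex.exp ((κ : ℂ) * Real.pi * Complex.I) = (-1) ^ κ := by
  rw [mul_assoc, Complex.exp_int_mul, Complex.exp_pi_mul_I]

/-- The reflection `θ ↦ π - θ` reverses the frequency. -/
lemma sinCpowIntegral_neg (α : ℂ) (κ : ℤ) :
    sinCpowIntegral α (-κ) = (-1) ^ κ * sinCpowIntegral α κ := by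
  have h := intervalIntegral.integral_comp_sub_left (a := 0) (b := Real.pi)
    (fun θ : ℝ => Complex.exp (((-κ : ℤ) : ℂ) * (θ : ℂ) * Complex.I) *
      ((Real.sin θ : ℝ) : ℂ) ^ α) Real.pi
  rw [sub_self, sub_zero] at h
  rw [sinCpowIntegral, ← h, sinCpowIntegral, ← intervalIntegral.integral_const_mul]
  congr 1
  ext θ
  rw [Real.sin_pi_sub, ← mul_assoc]
  congr 1
  have e : (-1 : ℂ) ^ κ = Complex.exp (((-κ : ℤ) : ℂ) * Real.pi * Complex.I) := by
    rw [exp_int_mul_pi_mul_I, zpow_neg, ← inv_zpow]; norm_num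
  rw [e, ← Complex.exp_add]
  push_cast
  congr 1
  ring

lemma sinCpowIntegral_one {α : ℂ} (hα : -1 < α.re) :
    sinCpowIntegral α 1 = Complex.I * sinCpowIntegral (α + 1) 0 := by
  have h1 : sinCpowIntegral α (-1) = -sinCpowIntegral α 1 := by
    simpa using sinCpowIntegral_neg α 1
  have h2 : sinCpowIntegral α 1 - sinCpowIntegral α (-1) =
      2 * Complex.I * sinCpowIntegral (α + 1) 0 := by
    simp only [sinCpowIntegral]
    rw [← intervalIntegral.integral_sub (intervalIntegrable_exp_mul_sin_cpow hα 1)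
      (intervalIntegrable_exp_mul_sin_cpow hα (-1)), ← intervalIntegral.integral_const_mul]
    refine intervalIntegral.integral_congr_uIoo fun θ hθ => ?_
    rw [Set.uIoo_of_le Real.pi_pos.le] at hθ
    have hs := Real.sin_pos_of_pos_of_lt_pi hθ.1 hθ.2
    have hne : ((Real.sin θ : ℝ) : ℂ) ≠ 0 := by exact_mod_cast hs.ne'
    simp only [Complex.cpow_add _ _ hne, Complex.cpow_one, Int.cast_one, one_mul, Int.cast_neg,
      Int.cast_zero, zero_mul, Complex.exp_zero]
    rw [neg_one_mul, Complex.exp_mul_I, Complex.exp_mul_I, Complex.cos_neg, Complex.sin_neg]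
    push_cast
    ring
  linear_combination (1 / 2 : ℂ) * h2 + (1 / 2 : ℂ) * h1

lemma sinCpowIntegral_zero {α : ℂ} (hα : -1 < α.re) :
    sinCpowIntegral α 0 = 2 ^ (-α) * Real.pi * Complex.Gamma (1 + α) *
      (Complex.Gamma (1 + α / 2))⁻¹ * (Complex.Gamma (1 + α / 2))⁻¹ := by
  have hs : 0 < ((α + 1) / 2).re := by simp; linarith
  have hb := Complex.Gamma_mul_Gamma_eq_betaIntegral hs hs
  have hd := Complex.Gamma_mul_Gamma_add_half ((α + 1) / 2)
  rw [betaIntegral_eq_sinCpowIntegral, show (α + 1) / 2 + (α + 1) / 2 = 1 + α by ring] at hb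
  rw [show (α + 1) / 2 + 1 / 2 = 1 + α / 2 by ring, show 2 * ((α + 1) / 2) = 1 + α by ring,
    show (1 : ℂ) - (1 + α) = -α by ring] at hd
  have hg : Complex.Gamma (1 + α) ≠ 0 :=
    Complex.Gamma_ne_zero_of_re_pos (by simp; linarith)
  have hg2 : Complex.Gamma (1 + α / 2) ≠ 0 :=
    Complex.Gamma_ne_zero_of_re_pos (by simp; linarith)
  have h2 : (2 : ℂ) ^ (-α) ≠ 0 := by simp [Complex.cpow_eq_zero_iff]
  have hpi : ((√Real.pi : ℝ) : ℂ) * ((√Real.pi : ℝ) : ℂ) = Real.pi := by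
    rw [← Complex.ofReal_mul, Real.mul_self_sqrt Real.pi_pos.le]
  rw [← hpi]
  generalize Complex.Gamma (1 + α / 2) = G at *
  field_simp
  apply mul_left_cancel₀ (mul_ne_zero hg h2)
  linear_combination (-G ^ 2) * hb +
    (Complex.Gamma ((α + 1) / 2) * G +
      Complex.Gamma (1 + α) * 2 ^ (-α) * ((√Real.pi : ℝ) : ℂ)) * hd

lemma sinCpowIntegral_natCast {α : ℂ} (hα : -1 < α.re) (n : ℕ) :
    sinCpowIntegral α n = Complex.I ^ n * 2 ^ (-α) * Real.pi * Complex.Gamma (1 + α) *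
      (Complex.Gamma (1 + α / 2 + n / 2))⁻¹ * (Complex.Gamma (1 + α / 2 - n / 2))⁻¹ := by
  induction n using Nat.twoStepInduction with
  | zero => simpa using sinCpowIntegral_zero hα
  | one =>
    have hne : (1 + α) ≠ 0 := fun h => by
      have := congrArg Complex.re h
      simp at this
      linarith
    have hr := Complex.one_div_Gamma_eq_self_mul_one_div_Gamma_add_one (1 + α / 2 - 1 / 2)
    rw [show 1 + α / 2 - 1 / 2 + 1 = 1 + (α + 1) / 2 by ring] at hr
    have h2 : (2 : ℂ) ^ (-(α + 1)) * 2 = 2 ^ (-α) := by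
      nth_rewrite 2 [← Complex.cpow_one 2]
      rw [← Complex.cpow_add _ _ two_ne_zero]
      congr 1
      ring
    have h1 := sinCpowIntegral_one hα
    rw [sinCpowIntegral_zero (α := α + 1) (by simp; linarith),
      show 1 + (α + 1) = (1 + α) + 1 by ring, Complex.Gamma_add_one _ hne] at h1
    simp only [Nat.cast_one, pow_one, h1]
    rw [hr, ← h2, show 1 + α / 2 + 1 / 2 = 1 + (α + 1) / 2 by ring]
    ring
  | more n ih _ =>
    have hne : α + 2 + n ≠ 0 := fun h => by
      have := congrArg Complex.re h
      simp at this
      linarith [(Nat.cast_nonneg n : (0 : ℝ) ≤ n)]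
    have hr := Complex.one_div_Gamma_eq_self_mul_one_div_Gamma_add_one (1 + α / 2 + n / 2)
    have hr' := Complex.one_div_Gamma_eq_self_mul_one_div_Gamma_add_one (α / 2 - n / 2)
    rw [show α / 2 - n / 2 + 1 = 1 + α / 2 - n / 2 by ring] at hr'
    have h := sinCpowIntegral_add_two hα n
    rw [ih, hr] at h
    simp only [Int.cast_natCast] at h
    apply mul_left_cancel₀ hne
    push_cast
    rw [h, show 1 + α / 2 + ((n : ℂ) + 2) / 2 = 1 + α / 2 + n / 2 + 1 by ring,
      show 1 + α / 2 - ((n : ℂ) + 2) / 2 = α / 2 - n / 2 by ring, hr', pow_add, Complex.I_sq]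
    ring

lemma sinCpowIntegral_eq {α : ℂ} (hα : -1 < α.re) (κ : ℤ) :
    sinCpowIntegral α κ = Complex.I ^ κ * 2 ^ (-α) * Real.pi * Complex.Gamma (1 + α) *
      (Complex.Gamma (1 + α / 2 + κ / 2))⁻¹ * (Complex.Gamma (1 + α / 2 - κ / 2))⁻¹ := by
  obtain ⟨n, rfl | rfl⟩ := κ.eq_nat_or_neg
  · simpa using sinCpowIntegral_natCast hα n
  · have hI : Complex.I ^ (-(n : ℤ)) = (-1) ^ n * Complex.I ^ n := by
      rw [zpow_neg, zpow_natCast, ← inv_pow, Complex.inv_I, ← mul_pow, neg_one_mul]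
    rw [sinCpowIntegral_neg, sinCpowIntegral_natCast hα n, hI, zpow_natCast]
    push_cast
    rw [neg_div, sub_neg_eq_add, ← sub_eq_add_neg]
    ring

/-- The values of `i^κ` separate into the cosine and sine of `κπ/2` by parity. -/
lemma one_add_neg_one_zpow_mul_I_zpow (ε : ℕ) (hε : ε = 0 ∨ ε = 1) (κ : ℤ) :
    (1 + (-1) ^ κ * (-1) ^ ε) * Complex.I ^ κ =
      2 * (((1 : ℂ) - (ε : ℂ)) * ((Real.cos ((κ : ℝ) * Real.pi / 2) : ℝ) : ℂ)
        + Complex.I * (ε : ℂ) * ((Real.sin ((κ : ℝ) * Real.pi / 2) : ℝ) : ℂ)) := by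
  have hI (m : ℤ) : Complex.I ^ (2 * m) = (-1) ^ m := by
    rw [zpow_mul, zpow_ofNat, Complex.I_sq]
  have hm (m : ℤ) : (-1 : ℂ) ^ (2 * m) = 1 := by
    rw [zpow_mul]; norm_num
  obtain ⟨m, rfl | rfl⟩ := κ.even_or_odd'
  · have e : ((2 * m : ℤ) : ℝ) * Real.pi / 2 = m * Real.pi := by push_cast; ring
    rw [e, Real.cos_int_mul_pi, Real.sin_int_mul_pi, hI, hm]
    rcases hε with rfl | rfl
    · norm_num
    · norm_num
  · have e : ((2 * m + 1 : ℤ) : ℝ) * Real.pi / 2 = m * Real.pi + Real.pi / 2 := by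
      push_cast; ring
    rw [e, Real.cos_add_pi_div_two, Real.sin_add_pi_div_two, Real.cos_int_mul_pi,
      Real.sin_int_mul_pi, zpow_add₀ Complex.I_ne_zero, zpow_add₀ (by norm_num), hI, hm]
    rcases hε with rfl | rfl
    · norm_num
    · norm_num
      ring

/-- for `ε ∈ {0,1}`, `Re α > -1`, `κ ∈ ℤ`,
`∫_{-π}^{π} e^{iκθ} sgn(sin θ)^ε |sin θ|^α dθ
  = σ(κ,ε) 2^{1-α} π Γ(1+α) / (Γ(1+α/2+κ/2) Γ(1+α/2-κ/2))`. -/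
theorem stmt_0 (ε : ℕ) (hε : ε = 0 ∨ ε = 1) (α : ℂ) (hα : -1 < α.re) (κ : ℤ) :
    (∫ θ in (-Real.pi)..Real.pi,
        Complex.exp ((κ : ℂ) * (θ : ℂ) * Complex.I) *
          ((Real.sign (Real.sin θ) : ℝ) : ℂ) ^ ε *
          ((|Real.sin θ| : ℝ) : ℂ) ^ α)
      = (((1 : ℂ) - (ε : ℂ)) * ((Real.cos ((κ : ℝ) * Real.pi / 2) : ℝ) : ℂ)
            + Complex.I * (ε : ℂ) * ((Real.sin ((κ : ℝ) * Real.pi / 2) : ℝ) : ℂ)) *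
          (2 : ℂ) ^ ((1 : ℂ) - α) * (Real.pi : ℂ) * Complex.Gamma (1 + α) /
          (Complex.Gamma (1 + α / 2 + (κ : ℂ) / 2) * Complex.Gamma (1 + α / 2 - (κ : ℂ) / 2)) := by
  set f : ℝ → ℂ := fun θ => Complex.exp ((κ : ℂ) * (θ : ℂ) * Complex.I) *
    ((Real.sign (Real.sin θ) : ℝ) : ℂ) ^ ε * ((|Real.sin θ| : ℝ) : ℂ) ^ α with hf
  set g : ℝ → ℂ := fun θ => Complex.exp ((κ : ℂ) * (θ : ℂ) * Complex.I) *
    ((Real.sin θ : ℝ) : ℂ) ^ α with hg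
  have hgi : IntervalIntegrable g volume 0 Real.pi := intervalIntegrable_exp_mul_sin_cpow hα κ
  have hpos : Set.EqOn g f (Set.uIoo 0 Real.pi) := by
    intro θ hθ
    rw [Set.uIoo_of_le Real.pi_pos.le] at hθ
    have hs := Real.sin_pos_of_pos_of_lt_pi hθ.1 hθ.2
    simp [hf, hg, Real.sign_of_pos hs, abs_of_pos hs]
  have hneg : Set.EqOn (fun θ => (-1) ^ κ * (-1) ^ ε * g θ) (fun θ => f (θ - Real.pi))
      (Set.uIoo 0 Real.pi) := by
    intro θ hθ
    rw [Set.uIoo_of_le Real.pi_pos.le] at hθ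
    have hs := Real.sin_pos_of_pos_of_lt_pi hθ.1 hθ.2
    have e : Complex.exp ((κ : ℂ) * ((θ - Real.pi : ℝ) : ℂ) * Complex.I) =
        (-1) ^ κ * Complex.exp ((κ : ℂ) * θ * Complex.I) := by
      have h1 : (-1 : ℂ) ^ κ = Complex.exp (((-κ : ℤ) : ℂ) * Real.pi * Complex.I) := by
        rw [exp_int_mul_pi_mul_I, zpow_neg, ← inv_zpow]; norm_num
      rw [h1, ← Complex.exp_add]
      push_cast
      congr 1
      ring
    simp only [hf, hg, e, Real.sin_sub_pi, abs_neg, abs_of_pos hs,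
      Real.sign_of_neg (neg_lt_zero.2 hs)]
    push_cast
    ring
  have hfi : IntervalIntegrable f volume 0 Real.pi := hgi.congr_uIoo hpos
  have hfi' : IntervalIntegrable f volume (-Real.pi) 0 := by
    have h := ((hgi.const_mul ((-1) ^ κ * (-1) ^ ε)).congr_uIoo hneg).comp_add_right Real.pi
    simpa using h
  have hI : ∫ θ in (-Real.pi)..0, f θ = (-1) ^ κ * (-1) ^ ε * sinCpowIntegral α κ := by
    have h := intervalIntegral.integral_comp_sub_right (a := 0) (b := Real.pi) f Real.pi
    rw [zero_sub, sub_self] at h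
    rw [← h, ← intervalIntegral.integral_congr_uIoo hneg, intervalIntegral.integral_const_mul]
    rfl
  have h2 : (2 : ℂ) ^ (1 - α) = 2 * 2 ^ (-α) := by
    rw [sub_eq_add_neg, Complex.cpow_add _ _ two_ne_zero, Complex.cpow_one]
  have hI' : ∫ θ in 0..Real.pi, f θ = sinCpowIntegral α κ :=
    (intervalIntegral.integral_congr_uIoo hpos).symm
  rw [← intervalIntegral.integral_add_adjacent_intervals hfi' hfi, hI, hI',
    sinCpowIntegral_eq hα, h2]
  linear_combination (2 ^ (-α) * Real.pi * Complex.Gamma (1 + α) *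
      (Complex.Gamma (1 + α / 2 + κ / 2))⁻¹ * (Complex.Gamma (1 + α / 2 - κ / 2))⁻¹) *
    one_add_neg_one_zpow_mul_I_zpow ε hε κ
end

section
/- Let ζ ∈ ℂ and ε ∈ {0,1}. Let f, g : ℝ²∖{(0,0)} → ℂ be continuous, with f homogeneous of degree 2ζ−1, g homogeneous of degree −2ζ−1, and both of parity ε. Then t ↦ f(1,t)·g(1,t) is absolutely integrable on ℝ and ∫_ℝ f(1,t)·g(1,t) dt = ∫_{−π/2}^{π/2} f(cos θ, sin θ)·g(cos θ, sin θ) dθ = (1/2)·∫_{−π}^{π} f(cos θ, sin θ)·g(cos θ, sin θ) dθ. -/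
open MeasureTheory

/-- `f` is homogeneous of degree `2ζ-1` on `ℝ² ∖ {0}`. -/
def IsHomog (ζ : ℂ) (f : ℝ × ℝ → ℂ) : Prop :=
  ∀ δ : ℝ, 0 < δ → ∀ v : ℝ × ℝ, v ≠ 0 → f (δ • v) = ((δ : ℂ) ^ (2 * ζ - 1)) * f v

/-- `f` has parity `ε ∈ {0,1}` on `ℝ² ∖ {0}`. -/
def HasParity (ε : ℕ) (f : ℝ × ℝ → ℂ) : Prop :=
  ∀ v : ℝ × ℝ, v ≠ 0 → f (-v) = (-1 : ℂ) ^ ε * f v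

/-- The product of functions homogeneous of degrees `2ζ-1` and `-2ζ-1` is homogeneous of
degree `-2`. -/
theorem IsHomog.mul_smul {ζ : ℂ} {f g : ℝ × ℝ → ℂ} (hf : IsHomog ζ f) (hg : IsHomog (-ζ) g)
    {δ : ℝ} (hδ : 0 < δ) {v : ℝ × ℝ} (hv : v ≠ 0) :
    f (δ • v) * g (δ • v) = ((δ : ℂ) ^ 2)⁻¹ * (f v * g v) := by
  have hδ' : (δ : ℂ) ≠ 0 := Complex.ofReal_ne_zero.mpr hδ.ne'
  have hpow : (δ : ℂ) ^ (2 * ζ - 1) * (δ : ℂ) ^ (2 * -ζ - 1) = ((δ : ℂ) ^ 2)⁻¹ := by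
    rw [← Complex.cpow_add _ _ hδ', show 2 * ζ - 1 + (2 * -ζ - 1) = -((2 : ℕ) : ℂ) by
      push_cast; ring, Complex.cpow_neg, Complex.cpow_natCast]
  rw [hf δ hδ v hv, hg δ hδ v hv, ← hpow]
  ring

/-- The product of two functions of the same parity is even. -/
theorem HasParity.mul_neg {ε : ℕ} {f g : ℝ × ℝ → ℂ} (hf : HasParity ε f) (hg : HasParity ε g)
    {v : ℝ × ℝ} (hv : v ≠ 0) : f (-v) * g (-v) = f v * g v := by
  have hsq : (-1 : ℂ) ^ ε * (-1) ^ ε = 1 := by rw [← mul_pow]; simp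
  rw [hf v hv, hg v hv]
  linear_combination f v * g v * hsq

theorem cos_sin_ne_zero (θ : ℝ) : ((Real.cos θ, Real.sin θ) : ℝ × ℝ) ≠ 0 := by
  intro h
  have hc : Real.cos θ = 0 := congrArg Prod.fst h
  have hs : Real.sin θ = 0 := congrArg Prod.snd h
  simpa [hc, hs] using Real.sin_sq_add_cos_sq θ

/-- A function homogeneous of degree `-2` and pulled back along `arctan` acquires the Jacobian
factor `1 + t ^ 2`. -/
theorem abs_deriv_arctan_smul_eq {F : ℝ × ℝ → ℂ}
    (hF : ∀ δ : ℝ, 0 < δ → ∀ v : ℝ × ℝ, v ≠ 0 → F (δ • v) = ((δ : ℂ) ^ 2)⁻¹ * F v) (t : ℝ) :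
    |1 / (1 + t ^ 2)| • F (Real.cos (Real.arctan t), Real.sin (Real.arctan t)) = F (1, t) := by
  have hpos : (0 : ℝ) < 1 + t ^ 2 := by positivity
  have hv : ((Real.cos (Real.arctan t), Real.sin (Real.arctan t)) : ℝ × ℝ)
      = Real.cos (Real.arctan t) • ((1, t) : ℝ × ℝ) := by
    ext
    · simp
    · simp [Real.sin_arctan, Real.cos_arctan, div_eq_inv_mul]
  rw [hv, hF _ (Real.cos_arctan_pos t) _ (by simp), ← Complex.ofReal_pow, Real.cos_sq_arctan,
    abs_of_pos (by positivity), Complex.real_smul, ← mul_assoc, ← Complex.ofReal_inv,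
    ← Complex.ofReal_mul, mul_inv_cancel₀ (by positivity), Complex.ofReal_one, one_mul]

/-- The integral over a double period is twice the integral over a centred period. -/
theorem Function.Periodic.intervalIntegral_neg_eq_two_mul {h : ℝ → ℂ} {T : ℝ}
    (hper : Function.Periodic h T) (hc : Continuous h) :
    ∫ x in (-T)..T, h x = 2 * ∫ x in (-(T / 2))..(T / 2), h x := by
  have h₁ := hper.intervalIntegral_add_eq (-T) (-(T / 2))
  have h₂ := hper.intervalIntegral_add_eq 0 (-(T / 2))
  rw [neg_add_cancel, show -(T / 2) + T = T / 2 by ring] at h₁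
  rw [zero_add, show -(T / 2) + T = T / 2 by ring] at h₂
  rw [← intervalIntegral.integral_add_adjacent_intervals (hc.intervalIntegrable (-T) 0)
    (hc.intervalIntegrable 0 T), h₁, h₂, two_mul]

/-- if `f` is continuous, homogeneous of degree `2ζ-1`, `g` continuous,
homogeneous of degree `-2ζ-1`, both of parity `ε`, then `t ↦ f(1,t)g(1,t)` is integrable and
`∫_ℝ f(1,t)g(1,t) dt = ∫_{-π/2}^{π/2} f(cos θ, sin θ)g(cos θ, sin θ) dθ
  = (1/2)∫_{-π}^{π} f(cos θ, sin θ)g(cos θ, sin θ) dθ`. -/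
theorem stmt_3 (ζ : ℂ) (ε : ℕ) (hε : ε = 0 ∨ ε = 1) (f g : ℝ × ℝ → ℂ)
    (hfc : ContinuousOn f {v : ℝ × ℝ | v ≠ 0}) (hgc : ContinuousOn g {v : ℝ × ℝ | v ≠ 0})
    (hf : IsHomog ζ f) (hg : IsHomog (-ζ) g)
    (hfp : HasParity ε f) (hgp : HasParity ε g) :
    Integrable (fun t : ℝ => f (1, t) * g (1, t)) ∧
    (∫ t : ℝ, f (1, t) * g (1, t))
      = (∫ θ in (-(Real.pi/2))..(Real.pi/2),
          f (Real.cos θ, Real.sin θ) * g (Real.cos θ, Real.sin θ)) ∧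
    (∫ t : ℝ, f (1, t) * g (1, t))
      = (1/2) * ∫ θ in (-Real.pi)..Real.pi,
          f (Real.cos θ, Real.sin θ) * g (Real.cos θ, Real.sin θ) := by
  set F : ℝ × ℝ → ℂ := fun v => f v * g v with hFdef
  have hF : ∀ δ : ℝ, 0 < δ → ∀ v : ℝ × ℝ, v ≠ 0 → F (δ • v) = ((δ : ℂ) ^ 2)⁻¹ * F v :=
    fun δ hδ v hv => hf.mul_smul hg hδ hv
  set h : ℝ → ℂ := fun θ => F (Real.cos θ, Real.sin θ) with hhdef
  have hcont : Continuous h :=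
    (hfc.mul hgc).comp_continuous (Real.continuous_cos.prodMk Real.continuous_sin) cos_sin_ne_zero
  have hper : Function.Periodic h Real.pi := fun θ => by
    simpa [hhdef, hFdef, Real.cos_add_pi, Real.sin_add_pi] using
      hfp.mul_neg hgp (cos_sin_ne_zero θ)
  have hderiv : ∀ t ∈ Set.univ, HasDerivWithinAt Real.arctan (1 / (1 + t ^ 2)) Set.univ t :=
    fun t _ => (Real.hasDerivAt_arctan t).hasDerivWithinAt
  have himage : Real.arctan '' Set.univ = Set.Ioo (-(Real.pi / 2)) (Real.pi / 2) := by
    rw [Set.image_univ, Real.range_arctan]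
  have hint : Integrable fun t : ℝ => F (1, t) := by
    have := (integrableOn_image_iff_integrableOn_abs_deriv_smul MeasurableSet.univ hderiv
      Real.arctan_injective.injOn h).mp
      (himage ▸ (hcont.integrableOn_Icc.mono_set Set.Ioo_subset_Icc_self))
    simpa only [hhdef, abs_deriv_arctan_smul_eq hF, integrableOn_univ] using this
  have heq : ∫ t : ℝ, F (1, t) = ∫ θ in (-(Real.pi / 2))..(Real.pi / 2), h θ := by
    have := integral_image_eq_integral_abs_deriv_smul MeasurableSet.univ hderiv
      Real.arctan_injective.injOn h
    simp only [hhdef, abs_deriv_arctan_smul_eq hF, setIntegral_univ, himage] at this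
    rw [intervalIntegral.integral_of_le (by linarith [Real.pi_pos]), integral_Ioc_eq_integral_Ioo,
      ← this]
  refine ⟨hint, heq, heq.trans ?_⟩
  change _ = (1 / 2) * ∫ θ in (-Real.pi)..Real.pi, h θ
  rw [hper.intervalIntegral_neg_eq_two_mul hcont]
  ring
end

section
/- Let ζ ∈ ℂ and ε ∈ {0,1}. Let f, g : ℝ²∖{(0,0)} → ℂ be continuous, with f homogeneous of degree 2ζ−1, g homogeneous of degree −2ζ−1, and both of parity ε. Then for every x ∈ SL(2,ℝ), ∫_{−π}^{π} f((cos θ, sin θ)·x)·g((cos θ, sin θ)·x) dθ = ∫_{−π}^{π} f(cos θ, sin θ)·g(cos θ, sin θ) dθ. -/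
open MeasureTheory

/-- The right action of `SL(2,ℝ)` on row vectors `v ∈ ℝ²`: `v · x`. -/
def rowAct (x : Matrix.SpecialLinearGroup (Fin 2) ℝ) (v : ℝ × ℝ) : ℝ × ℝ :=
  (v.1 * x.1 0 0 + v.2 * x.1 1 0, v.1 * x.1 0 1 + v.2 * x.1 1 1)

theorem isCompact_preimage_norm_Icc (L : (ℝ × ℝ) ≃L[ℝ] ℝ × ℝ) (a b : ℝ) :
    IsCompact {v : ℝ × ℝ | ‖L v‖ ∈ Set.Icc a b} := by
  have hc : IsCompact (L ⁻¹' Metric.closedBall 0 b) :=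
    L.toHomeomorph.isCompact_preimage.2 (isCompact_closedBall 0 b)
  refine hc.of_isClosed_subset
    (isClosed_Icc.preimage (L.continuous.norm)) fun v hv => ?_
  simpa using hv.2

/-- The integral over a ray of a function of degree `-2`, restricted to a logarithmic shell of
length `1`, is its value at the generator of the ray. -/
theorem integral_Ioi_smul_indicator_shell {h : ℝ × ℝ → ℂ}
    (hom : ∀ δ : ℝ, 0 < δ → ∀ v : ℝ × ℝ, v ≠ 0 → h (δ • v) = (δ ^ 2)⁻¹ • h v)
    (L : (ℝ × ℝ) ≃L[ℝ] ℝ × ℝ) {v : ℝ × ℝ} (hv : v ≠ 0) :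
    ∫ r in Set.Ioi (0 : ℝ),
      r • {w : ℝ × ℝ | ‖L w‖ ∈ Set.Icc 1 (Real.exp 1)}.indicator h (r • v) = h v := by
  have hN : 0 < ‖L v‖ := norm_pos_iff.2 (by simpa using hv)
  have hle : 1 / ‖L v‖ ≤ Real.exp 1 / ‖L v‖ := by
    gcongr
    exact Real.one_le_exp zero_le_one
  have hpos : 0 < 1 / ‖L v‖ := by positivity
  have key : ∀ r ∈ Set.Ioi (0 : ℝ),
      r • {w : ℝ × ℝ | ‖L w‖ ∈ Set.Icc 1 (Real.exp 1)}.indicator h (r • v)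
        = (Set.Icc (1 / ‖L v‖) (Real.exp 1 / ‖L v‖)).indicator (fun r : ℝ => r⁻¹ • h v) r := by
    intro r hr
    have hr : 0 < r := hr
    have hiff : r • v ∈ {w : ℝ × ℝ | ‖L w‖ ∈ Set.Icc 1 (Real.exp 1)} ↔
        r ∈ Set.Icc (1 / ‖L v‖) (Real.exp 1 / ‖L v‖) := by
      simp only [Set.mem_ofPred_eq, map_smul, norm_smul, Real.norm_of_nonneg hr.le, Set.mem_Icc,
        div_le_iff₀ hN, le_div_iff₀ hN]
    by_cases hmem : r ∈ Set.Icc (1 / ‖L v‖) (Real.exp 1 / ‖L v‖)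
    · rw [Set.indicator_of_mem hmem, Set.indicator_of_mem (hiff.2 hmem), hom r hr v hv, smul_smul]
      congr 1
      field_simp
    · rw [Set.indicator_of_notMem hmem, Set.indicator_of_notMem (mt hiff.1 hmem), smul_zero]
  rw [setIntegral_congr_fun measurableSet_Ioi key, setIntegral_indicator measurableSet_Icc,
    Set.inter_eq_right.2 (Set.Icc_subset_Ioi_iff hle |>.2 hpos), integral_Icc_eq_integral_Ioc,
    ← intervalIntegral.integral_of_le hle, intervalIntegral.integral_smul_const,
    integral_inv_of_pos hpos (hpos.trans_le hle)]
  have : Real.exp 1 / ‖L v‖ / (1 / ‖L v‖) = Real.exp 1 := by field_simp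
  rw [this, Real.log_exp, one_smul]

theorem integral_indicator_shell {h : ℝ × ℝ → ℂ} (hc : ContinuousOn h {v : ℝ × ℝ | v ≠ 0})
    (hom : ∀ δ : ℝ, 0 < δ → ∀ v : ℝ × ℝ, v ≠ 0 → h (δ • v) = (δ ^ 2)⁻¹ • h v)
    (L : (ℝ × ℝ) ≃L[ℝ] ℝ × ℝ) :
    ∫ v, {w : ℝ × ℝ | ‖L w‖ ∈ Set.Icc 1 (Real.exp 1)}.indicator h v
      = ∫ θ in (-Real.pi)..Real.pi, h (Real.cos θ, Real.sin θ) := by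
  have hK := isCompact_preimage_norm_Icc L 1 (Real.exp 1)
  have hint : Integrable ({w : ℝ × ℝ | ‖L w‖ ∈ Set.Icc 1 (Real.exp 1)}.indicator h) := by
    rw [integrable_indicator_iff hK.measurableSet]
    refine (hc.mono fun v hv => ?_).integrableOn_compact hK
    rintro rfl
    have h0 : (1 : ℝ) ≤ ‖L 0‖ := hv.1
    norm_num at h0
  set F := {w : ℝ × ℝ | ‖L w‖ ∈ Set.Icc 1 (Real.exp 1)}.indicator h with hF
  have hpolar : IntegrableOn (fun p : ℝ × ℝ => p.1 • F (polarCoord.symm p))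
      (Set.Ioi (0 : ℝ) ×ˢ Set.Ioo (-Real.pi) Real.pi) := by
    have himage := (integrableOn_image_iff_integrableOn_abs_det_fderiv_smul volume
      polarCoord.open_target.measurableSet
      (fun p _ => (hasFDerivAt_polarCoord_symm p).hasFDerivWithinAt)
      polarCoord.symm.injOn F).1 hint.integrableOn
    refine himage.congr_fun (fun p hp => ?_) polarCoord.open_target.measurableSet
    simp only [det_fderivPolarCoordSymm, abs_of_pos (show 0 < p.1 from hp.1)]
  rw [← integral_comp_polarCoord_symm, polarCoord_target, Measure.volume_eq_prod,
    ← Measure.prod_restrict, integral_prod_symm _ (by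
      rwa [Measure.prod_restrict, ← Measure.volume_eq_prod]),
    intervalIntegral.integral_of_le (by linarith [Real.pi_pos]), ← integral_Ioc_eq_integral_Ioo]
  refine integral_congr_ae (Filter.Eventually.of_forall fun θ => ?_)
  have := integral_Ioi_smul_indicator_shell hom L (cos_sin_ne_zero θ)
  simpa [polarCoord_symm_apply, hF] using this

/-- The action of `x ∈ SL(2,ℝ)` on row vectors, as a linear map. -/
noncomputable def rowActLinear (x : Matrix.SpecialLinearGroup (Fin 2) ℝ) :
    ℝ × ℝ →ₗ[ℝ] ℝ × ℝ :=
  Matrix.toLin (.finTwoProd ℝ) (.finTwoProd ℝ) !![x.1 0 0, x.1 1 0; x.1 0 1, x.1 1 1]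

theorem rowActLinear_apply (x : Matrix.SpecialLinearGroup (Fin 2) ℝ) (v : ℝ × ℝ) :
    rowActLinear x v = rowAct x v := by
  rw [rowActLinear, Matrix.toLin_finTwoProd_apply, rowAct]
  ext <;> ring

theorem det_rowActLinear (x : Matrix.SpecialLinearGroup (Fin 2) ℝ) :
    LinearMap.det (rowActLinear x) = 1 := by
  have hx := x.2
  rw [Matrix.det_fin_two] at hx
  rw [rowActLinear, LinearMap.det_toLin, Matrix.det_fin_two_of]
  linarith

/-- The action of `x ∈ SL(2,ℝ)` on row vectors, as a continuous linear equivalence. -/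
noncomputable def rowActEquiv (x : Matrix.SpecialLinearGroup (Fin 2) ℝ) :
    (ℝ × ℝ) ≃L[ℝ] ℝ × ℝ :=
  (LinearMap.equivOfDetNeZero (rowActLinear x)
    (by rw [det_rowActLinear]; exact one_ne_zero)).toContinuousLinearEquiv

theorem rowActEquiv_apply (x : Matrix.SpecialLinearGroup (Fin 2) ℝ) (v : ℝ × ℝ) :
    rowActEquiv x v = rowAct x v :=
  rowActLinear_apply x v

theorem measurePreserving_rowActEquiv (x : Matrix.SpecialLinearGroup (Fin 2) ℝ) :
    MeasurePreserving (rowActEquiv x) := by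
  refine ⟨(rowActEquiv x).continuous.measurable, ?_⟩
  have h := Measure.map_linearMap_addHaar_eq_smul_addHaar (volume : Measure (ℝ × ℝ))
    (f := rowActLinear x) (by rw [det_rowActLinear]; exact one_ne_zero)
  rwa [det_rowActLinear, inv_one, abs_one, ENNReal.ofReal_one, one_smul] at h

/-- The integral over the unit circle of a function of degree `-2` is `SL(2,ℝ)`-invariant. -/
theorem integral_circle_rowAct {h : ℝ × ℝ → ℂ} (hc : ContinuousOn h {v : ℝ × ℝ | v ≠ 0})
    (hom : ∀ δ : ℝ, 0 < δ → ∀ v : ℝ × ℝ, v ≠ 0 → h (δ • v) = (δ ^ 2)⁻¹ • h v)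
    (x : Matrix.SpecialLinearGroup (Fin 2) ℝ) :
    ∫ θ in (-Real.pi)..Real.pi, h (rowAct x (Real.cos θ, Real.sin θ))
      = ∫ θ in (-Real.pi)..Real.pi, h (Real.cos θ, Real.sin θ) := by
  set e := rowActEquiv x
  have hne : ∀ v : ℝ × ℝ, v ≠ 0 → e v ≠ 0 := fun v hv => by simpa using hv
  have hcx : ContinuousOn (h ∘ e) {v : ℝ × ℝ | v ≠ 0} :=
    hc.comp e.continuous.continuousOn hne
  have homx : ∀ δ : ℝ, 0 < δ → ∀ v : ℝ × ℝ, v ≠ 0 →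
      (h ∘ e) (δ • v) = (δ ^ 2)⁻¹ • (h ∘ e) v := fun δ hδ v hv => by
    simp only [Function.comp_apply, map_smul]
    exact hom δ hδ _ (hne v hv)
  simp only [← rowActEquiv_apply]
  refine (integral_indicator_shell hcx homx (.refl ℝ _)).symm.trans ?_
  have hmap := (measurePreserving_rowActEquiv x).integral_comp
    e.toHomeomorph.measurableEmbedding
    ({w : ℝ × ℝ | ‖e.symm w‖ ∈ Set.Icc 1 (Real.exp 1)}.indicator h)
  rw [integral_indicator_shell hc hom e.symm] at hmap
  refine Eq.trans ?_ hmap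
  refine integral_congr_ae (Filter.Eventually.of_forall fun v => ?_)
  simp [Set.indicator, e]

theorem IsHomog.mul_neg {ζ : ℂ} {f g : ℝ × ℝ → ℂ} (hf : IsHomog ζ f) (hg : IsHomog (-ζ) g)
    (δ : ℝ) (hδ : 0 < δ) (v : ℝ × ℝ) (hv : v ≠ 0) :
    f (δ • v) * g (δ • v) = (δ ^ 2)⁻¹ • (f v * g v) := by
  have hδ' : (δ : ℂ) ≠ 0 := by exact_mod_cast hδ.ne'
  have hpow : (δ : ℂ) ^ (2 * ζ - 1) * (δ : ℂ) ^ (2 * -ζ - 1) = ((δ : ℂ) ^ 2)⁻¹ := by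
    rw [← Complex.cpow_add _ _ hδ', show 2 * ζ - 1 + (2 * -ζ - 1) = -(2 : ℕ) by push_cast; ring,
      Complex.cpow_neg, Complex.cpow_natCast]
  rw [hf δ hδ v hv, hg δ hδ v hv, mul_mul_mul_comm, hpow, Complex.real_smul]
  push_cast
  rfl

/-- with `f` continuous homogeneous of degree `2ζ-1`, `g` continuous homogeneous
of degree `-2ζ-1`, both of parity `ε`, the pairing
`∫_{-π}^{π} f((cos θ, sin θ)·x) g((cos θ, sin θ)·x) dθ` is independent of `x ∈ SL(2,ℝ)`. -/
theorem stmt_4 (ζ : ℂ) (ε : ℕ) (hε : ε = 0 ∨ ε = 1) (f g : ℝ × ℝ → ℂ)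
    (hfc : ContinuousOn f {v : ℝ × ℝ | v ≠ 0}) (hgc : ContinuousOn g {v : ℝ × ℝ | v ≠ 0})
    (hf : IsHomog ζ f) (hg : IsHomog (-ζ) g)
    (hfp : HasParity ε f) (hgp : HasParity ε g) :
    ∀ x : Matrix.SpecialLinearGroup (Fin 2) ℝ,
      (∫ θ in (-Real.pi)..Real.pi,
          f (rowAct x (Real.cos θ, Real.sin θ)) * g (rowAct x (Real.cos θ, Real.sin θ)))
        = ∫ θ in (-Real.pi)..Real.pi,
            f (Real.cos θ, Real.sin θ) * g (Real.cos θ, Real.sin θ) := by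
  intro x
  exact integral_circle_rowAct (hfc.mul hgc) (hf.mul_neg hg) x
end

section
/- Let ζ ∈ ℂ with −1/2 < Re ζ < 0 and ε ∈ {0,1}. Let f, g : ℝ²∖{(0,0)} → ℂ be continuous and homogeneous of degree 2ζ−1. Then the following double integrals converge absolutely and ∬_{ℝ×ℝ} f(1,t)·g(1,u)·sgn(u−t)^ε·|u−t|^{−1−2ζ} dt du = ∬_{(−π/2,π/2)×(−π/2,π/2)} f(cos θ, sin θ)·g(cos φ, sin φ)·sgn(sin(φ−θ))^ε·|sin(φ−θ)|^{−1−2ζ} dφ dθ. If moreover f and g both have parity ε, then these are also equal to (1/4)·∬_{(−π,π)×(−π,π)} f(cos θ, sin θ)·g(cos φ, sin φ)·sgn(sin(φ−θ))^ε·|sin(φ−θ)|^{−1−2ζ} dφ dθ. -/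
open MeasureTheory

open Real Set

theorem intervalIntegrable_abs_sin_rpow {a : ℝ} (ha : -1 < a) (ha' : a ≤ 0) (b c : ℝ) :
    IntervalIntegrable (fun x : ℝ => |sin x| ^ a) volume b c := by
  have hper : Function.Periodic (fun x : ℝ => |sin x| ^ a) π := fun x => by
    simp [sin_add_pi]
  refine hper.intervalIntegrable (t := -(π / 2)) pi_ne_zero ?_ b c
  have hcpow : IntervalIntegrable (fun x : ℝ => (x : ℂ) ^ (a : ℂ)) volume (-(π / 2))
      (-(π / 2) + π) := intervalIntegral.intervalIntegrable_cpow' (by simpa using ha)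
  have habs : IntervalIntegrable (fun x : ℝ => (2 / π) ^ a * |x| ^ a) volume (-(π / 2))
      (-(π / 2) + π) := by
    simpa [Complex.norm_cpow_real] using hcpow.norm.const_mul ((2 / π) ^ a)
  refine habs.mono_fun' ?_ ?_
  · exact (by fun_prop : Measurable fun x : ℝ => |sin x| ^ a).aestronglyMeasurable
  · refine (ae_restrict_iff' measurableSet_uIoc).2 (.of_forall fun x hx => ?_)
    have hx' : |x| ≤ π / 2 := by
      rw [uIoc_of_le (by linarith [pi_pos])] at hx
      exact abs_le.2 ⟨hx.1.le, by linarith [hx.2]⟩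
    beta_reduce
    rw [norm_of_nonneg (by positivity), ← mul_rpow (by positivity) (abs_nonneg x)]
    rcases eq_or_ne x 0 with rfl | h0
    · simp
    · exact rpow_le_rpow_of_nonpos (by positivity) (mul_abs_le_abs_sin hx') ha'

theorem integrableOn_abs_sin_sub_rpow {a : ℝ} (ha : -1 < a) (ha' : a ≤ 0) :
    IntegrableOn (fun q : ℝ × ℝ => |sin (q.2 - q.1)| ^ a) (Ioo (-π) π ×ˢ Ioo (-π) π) := by
  have h1 : Integrable ((Ioo (-π) π).indicator fun _ : ℝ => (1 : ℝ)) :=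
    (integrable_indicator_iff measurableSet_Ioo).2 (by simp [integrableOn_const_iff])
  have h2 : Integrable ((Ioc (-(2 * π)) (2 * π)).indicator fun x : ℝ => |sin x| ^ a) :=
    (integrable_indicator_iff measurableSet_Ioc).2
      ((intervalIntegrable_iff_integrableOn_Ioc_of_le (by linarith [pi_pos])).1
        (intervalIntegrable_abs_sin_rpow ha ha' _ _))
  have h3 := (h1.convolution_integrand (ContinuousLinearMap.mul ℝ ℝ) h2).swap
  refine (h3.integrableOn (s := Ioo (-π) π ×ˢ Ioo (-π) π)).congr_fun ?_
    (measurableSet_Ioo.prod measurableSet_Ioo)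
  rintro ⟨x, y⟩ ⟨hx, hy⟩
  have hxy : y - x ∈ Ioc (-(2 * π)) (2 * π) :=
    ⟨by linarith [hx.2, hy.1], by linarith [hx.1, hy.2]⟩
  simp_all

theorem measurable_real_sign : Measurable Real.sign :=
  Measurable.ite measurableSet_Iio measurable_const
    (Measurable.ite measurableSet_Ioi measurable_const measurable_const)

theorem norm_sign_pow_le_one (r : ℝ) (n : ℕ) : ‖((Real.sign r : ℝ) : ℂ) ^ n‖ ≤ 1 := by
  rw [norm_pow]
  refine pow_le_one₀ (norm_nonneg _) ?_
  rcases Real.sign_apply_eq r with h | h | h <;> simp [h]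

theorem sign_mul_of_pos {c : ℝ} (hc : 0 < c) (r : ℝ) : Real.sign (c * r) = Real.sign r := by
  rcases lt_trichotomy r 0 with h | rfl | h
  · rw [Real.sign_of_neg h, Real.sign_of_neg (mul_neg_of_pos_of_neg hc h)]
  · simp
  · rw [Real.sign_of_pos h, Real.sign_of_pos (mul_pos hc h)]

theorem norm_ofReal_abs_cpow {s : ℂ} (hs : s.re ≠ 0) (r : ℝ) :
    ‖((|r| : ℝ) : ℂ) ^ s‖ = |r| ^ s.re :=
  Complex.norm_cpow_eq_rpow_re_of_nonneg (abs_nonneg r) hs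

theorem cos_sin_ne_zero_s6 (x : ℝ) : ((cos x, sin x) : ℝ × ℝ) ≠ 0 := fun h => by
  have h1 := congrArg Prod.fst h
  have h2 := congrArg Prod.snd h
  have h3 := sin_sq_add_cos_sq x
  simp_all

theorem continuous_comp_cos_sin {f : ℝ × ℝ → ℂ} (hf : ContinuousOn f {v : ℝ × ℝ | v ≠ 0}) :
    Continuous fun x : ℝ => f (cos x, sin x) :=
  hf.comp_continuous (by fun_prop) cos_sin_ne_zero_s6

theorem exists_norm_comp_cos_sin_le {f : ℝ × ℝ → ℂ}
    (hf : ContinuousOn f {v : ℝ × ℝ | v ≠ 0}) : ∃ C, ∀ x : ℝ, ‖f (cos x, sin x)‖ ≤ C := by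
  have hper : Function.Periodic (fun x : ℝ => f (cos x, sin x)) (2 * π) := fun x => by simp
  obtain ⟨C, hC⟩ :=
    (hper.isBounded_of_continuous two_pi_pos.ne' (continuous_comp_cos_sin hf)).exists_norm_le
  exact ⟨C, fun x => hC _ ⟨x, rfl⟩⟩

/-- The integrand on the circle, in angular coordinates. -/
noncomputable def circleIntegrand (f g : ℝ × ℝ → ℂ) (ε : ℕ) (s : ℂ) (q : ℝ × ℝ) : ℂ :=
  f (cos q.1, sin q.1) * g (cos q.2, sin q.2) *
    ((Real.sign (sin (q.2 - q.1)) : ℝ) : ℂ) ^ ε * ((|sin (q.2 - q.1)| : ℝ) : ℂ) ^ s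

/-- The integrand on the affine line `{(1, t)}`. -/
noncomputable def lineIntegrand (f g : ℝ × ℝ → ℂ) (ε : ℕ) (s : ℂ) (p : ℝ × ℝ) : ℂ :=
  f (1, p.1) * g (1, p.2) * ((Real.sign (p.2 - p.1) : ℝ) : ℂ) ^ ε *
    ((|p.2 - p.1| : ℝ) : ℂ) ^ s

theorem integrableOn_circleIntegrand {f g : ℝ × ℝ → ℂ}
    (hf : ContinuousOn f {v : ℝ × ℝ | v ≠ 0}) (hg : ContinuousOn g {v : ℝ × ℝ | v ≠ 0})
    (ε : ℕ) {s : ℂ} (hs : -1 < s.re) (hs' : s.re < 0) :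
    IntegrableOn (circleIntegrand f g ε s) (Ioo (-π) π ×ˢ Ioo (-π) π) := by
  obtain ⟨C, hC⟩ := exists_norm_comp_cos_sin_le hf
  obtain ⟨D, hD⟩ := exists_norm_comp_cos_sin_le hg
  refine Integrable.mono' ((integrableOn_abs_sin_sub_rpow hs hs'.le).const_mul (C * D)) ?_
    (.of_forall fun q => ?_)
  · have hf' := (continuous_comp_cos_sin hf).measurable
    have hg' := (continuous_comp_cos_sin hg).measurable
    have hsin : Measurable fun q : ℝ × ℝ => sin (q.2 - q.1) := by fun_prop
    have hsign : Measurable fun q : ℝ × ℝ => ((Real.sign (sin (q.2 - q.1)) : ℝ) : ℂ) ^ ε :=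
      (Complex.measurable_ofReal.comp (measurable_real_sign.comp hsin)).pow_const ε
    have hpow : Measurable fun q : ℝ × ℝ => ((|sin (q.2 - q.1)| : ℝ) : ℂ) ^ s := by fun_prop
    exact ((((hf'.comp measurable_fst).mul (hg'.comp measurable_snd)).mul hsign).mul
      hpow).aestronglyMeasurable
  · have hC0 : 0 ≤ C := (norm_nonneg _).trans (hC 0)
    rw [circleIntegrand, norm_mul, norm_mul, norm_mul, norm_ofReal_abs_cpow hs'.ne]
    refine mul_le_mul_of_nonneg_right ?_ (by positivity)
    calc _ ≤ C * D * 1 := by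
          gcongr
          · exact mul_nonneg hC0 ((norm_nonneg _).trans (hD 0))
          · exact hC _
          · exact hD _
          · exact norm_sign_pow_le_one _ _
      _ = C * D := mul_one _

theorem IsHomog.apply_one_tan {ζ : ℂ} {f : ℝ × ℝ → ℂ} (hf : IsHomog ζ f) {x : ℝ}
    (hx : 0 < cos x) :
    f (1, tan x) = (((cos x)⁻¹ : ℝ) : ℂ) ^ (2 * ζ - 1) * f (cos x, sin x) := by
  rw [← hf _ (inv_pos.2 hx) _ (cos_sin_ne_zero_s6 x)]
  congr 1
  ext
  · simp [hx.ne']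
  · simp [tan_eq_sin_div_cos, div_eq_inv_mul]

theorem tan_sub_tan {x y : ℝ} (hx : cos x ≠ 0) (hy : cos y ≠ 0) :
    tan y - tan x = (cos y)⁻¹ * (cos x)⁻¹ * sin (y - x) := by
  rw [tan_eq_sin_div_cos, tan_eq_sin_div_cos, sin_sub]
  field_simp

theorem smul_lineIntegrand_tan {ζ : ℂ} {f g : ℝ × ℝ → ℂ} (hf : IsHomog ζ f) (hg : IsHomog ζ g)
    (ε : ℕ) {x y : ℝ} (hx : 0 < cos x) (hy : 0 < cos y) :
    (1 / cos x ^ 2 * (1 / cos y ^ 2)) • lineIntegrand f g ε (-1 - 2 * ζ) (tan x, tan y) =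
      circleIntegrand f g ε (-1 - 2 * ζ) (x, y) := by
  have hx' := inv_pos.2 hx
  have hy' := inv_pos.2 hy
  have key : ∀ c : ℝ, 0 < c →
      ((c : ℂ) ^ 2) * ((c : ℂ) ^ (2 * ζ - 1) * (c : ℂ) ^ (-1 - 2 * ζ)) = 1 := fun c hc => by
    have hc' : (c : ℂ) ≠ 0 := mod_cast hc.ne'
    rw [← Complex.cpow_add _ _ hc', ← Complex.cpow_natCast, ← Complex.cpow_add _ _ hc']
    ring_nf
    simp
  have hX := key _ hx'
  have hY := key _ hy'
  simp only [lineIntegrand, circleIntegrand, hf.apply_one_tan hx, hg.apply_one_tan hy,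
    tan_sub_tan hx.ne' hy.ne', sign_mul_of_pos (mul_pos hy' hx'), abs_mul, abs_of_pos hx',
    abs_of_pos hy', Complex.ofReal_mul]
  rw [← Complex.ofReal_mul (cos y)⁻¹, Complex.mul_cpow_ofReal_nonneg (by positivity)
    (abs_nonneg _), Complex.ofReal_mul, Complex.mul_cpow_ofReal_nonneg hy'.le hx'.le,
    Complex.real_smul]
  have e : ((1 / cos x ^ 2 * (1 / cos y ^ 2) : ℝ) : ℂ) =
      (((cos x)⁻¹ : ℝ) : ℂ) ^ 2 * (((cos y)⁻¹ : ℝ) : ℂ) ^ 2 := by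
    push_cast
    simp
  rw [e]
  generalize (((cos x)⁻¹ : ℝ) : ℂ) = X at *
  generalize (((cos y)⁻¹ : ℝ) : ℂ) = Y at *
  generalize f (cos x, sin x) = F
  generalize g (cos y, sin y) = G
  generalize ((Real.sign (sin (y - x)) : ℝ) : ℂ) ^ ε = S
  generalize ((|sin (y - x)| : ℝ) : ℂ) ^ (-1 - 2 * ζ) = A
  linear_combination (Y ^ 2 * (Y ^ (2 * ζ - 1) * Y ^ (-1 - 2 * ζ)) * F * G * S * A) * hX +
    F * G * S * A * hY

section TanChangeOfVariables

variable {E : Type*} [NormedAddCommGroup E] [NormedSpace ℝ E]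

theorem image_prodMap_tan :
    Prod.map tan tan '' (Ioo (-(π / 2)) (π / 2) ×ˢ Ioo (-(π / 2)) (π / 2)) = univ := by
  rw [prodMap_image_prod, image_tan_Ioo, univ_prod_univ]

theorem hasFDerivWithinAt_prodMap_tan (q : ℝ × ℝ)
    (hq : q ∈ Ioo (-(π / 2)) (π / 2) ×ˢ Ioo (-(π / 2)) (π / 2)) :
    HasFDerivWithinAt (Prod.map tan tan)
      ((ContinuousLinearMap.toSpanSingleton ℝ (1 / cos q.1 ^ 2)).prodMap
        (ContinuousLinearMap.toSpanSingleton ℝ (1 / cos q.2 ^ 2)))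
      (Ioo (-(π / 2)) (π / 2) ×ˢ Ioo (-(π / 2)) (π / 2)) q :=
  (HasFDerivAt.prodMap q (hasDerivAt_tan (cos_pos_of_mem_Ioo hq.1).ne').hasFDerivAt
    (hasDerivAt_tan (cos_pos_of_mem_Ioo hq.2).ne').hasFDerivAt).hasFDerivWithinAt

theorem det_prodMap_toSpanSingleton (a b : ℝ) :
    ((ContinuousLinearMap.toSpanSingleton ℝ a).prodMap
      (ContinuousLinearMap.toSpanSingleton ℝ b)).det = a * b := by
  rw [ContinuousLinearMap.det, ContinuousLinearMap.coe_prodMap, LinearMap.det_prodMap]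
  simp

theorem integrable_iff_integrableOn_tan (F : ℝ × ℝ → E) :
    Integrable F ↔ IntegrableOn
      (fun q : ℝ × ℝ => (1 / cos q.1 ^ 2 * (1 / cos q.2 ^ 2)) • F (tan q.1, tan q.2))
      (Ioo (-(π / 2)) (π / 2) ×ˢ Ioo (-(π / 2)) (π / 2)) := by
  rw [← integrableOn_univ, ← image_prodMap_tan,
    integrableOn_image_iff_integrableOn_abs_det_fderiv_smul volume
      (measurableSet_Ioo.prod measurableSet_Ioo) hasFDerivWithinAt_prodMap_tan
      (injOn_tan.prodMap injOn_tan)]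
  simp only [det_prodMap_toSpanSingleton, Prod.map]
  simp_rw [fun q : ℝ × ℝ => abs_of_nonneg
    (show 0 ≤ 1 / cos q.1 ^ 2 * (1 / cos q.2 ^ 2) by positivity)]

theorem integral_eq_setIntegral_tan (F : ℝ × ℝ → E) :
    ∫ p, F p = ∫ q in Ioo (-(π / 2)) (π / 2) ×ˢ Ioo (-(π / 2)) (π / 2),
      (1 / cos q.1 ^ 2 * (1 / cos q.2 ^ 2)) • F (tan q.1, tan q.2) := by
  rw [← setIntegral_univ, ← image_prodMap_tan,
    integral_image_eq_integral_abs_det_fderiv_smul volume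
      (measurableSet_Ioo.prod measurableSet_Ioo) hasFDerivWithinAt_prodMap_tan
      (injOn_tan.prodMap injOn_tan)]
  simp only [det_prodMap_toSpanSingleton, Prod.map]
  simp_rw [fun q : ℝ × ℝ => abs_of_nonneg
    (show 0 ≤ 1 / cos q.1 ^ 2 * (1 / cos q.2 ^ 2) by positivity)]

end TanChangeOfVariables

theorem Function.Periodic.setIntegral_Ioo_neg_self {h : ℝ → ℂ} {T : ℝ}
    (hh : Function.Periodic h T) (hT : 0 < T) :
    ∫ x in Ioo (-T) T, h x = 2 * ∫ x in Ioo (-(T / 2)) (T / 2), h x := by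
  rw [← integral_Ioc_eq_integral_Ioo, ← integral_Ioc_eq_integral_Ioo,
    ← intervalIntegral.integral_of_le (by linarith),
    ← intervalIntegral.integral_of_le (by linarith)]
  by_cases hi : IntervalIntegrable h volume (-(T / 2)) (T / 2)
  · have hi' : ∀ a b, IntervalIntegrable h volume a b :=
      hh.intervalIntegrable (t := -(T / 2)) hT.ne' (by convert hi using 1; ring)
    have := hh.intervalIntegral_add_zsmul_eq 2 (-T) hi'
    rw [hh.intervalIntegral_add_eq (-T) (-(T / 2))] at this
    convert this using 2
    · simp; ring
    · simp; ring_nf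
  · rw [intervalIntegral.integral_undef hi, intervalIntegral.integral_undef, mul_zero]
    refine fun hi' => hi (hi'.mono_set ?_)
    rw [uIcc_of_le (by linarith), uIcc_of_le (by linarith)]
    exact Icc_subset_Icc (by linarith) (by linarith)

theorem setIntegral_prod_Ioo_neg_self_of_periodic {H : ℝ × ℝ → ℂ} {T : ℝ} (hT : 0 < T)
    (h1 : ∀ x y, H (x + T, y) = H (x, y)) (h2 : ∀ x y, H (x, y + T) = H (x, y))
    (hH : IntegrableOn H (Ioo (-T) T ×ˢ Ioo (-T) T)) :
    ∫ q in Ioo (-T) T ×ˢ Ioo (-T) T, H q =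
      4 * ∫ q in Ioo (-(T / 2)) (T / 2) ×ˢ Ioo (-(T / 2)) (T / 2), H q := by
  have hsub : Ioo (-(T / 2)) (T / 2) ⊆ Ioo (-T) T :=
    Ioo_subset_Ioo (by linarith) (by linarith)
  rw [Measure.volume_eq_prod] at hH ⊢
  rw [setIntegral_prod _ hH, setIntegral_prod _ (hH.mono_set (prod_mono hsub hsub))]
  have hin : ∀ x, ∫ y in Ioo (-T) T, H (x, y) =
      2 * ∫ y in Ioo (-(T / 2)) (T / 2), H (x, y) := fun x =>
    Function.Periodic.setIntegral_Ioo_neg_self (fun y => h2 x y) hT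
  simp_rw [hin]
  rw [integral_const_mul, Function.Periodic.setIntegral_Ioo_neg_self
    (h := fun x => ∫ y in Ioo (-(T / 2)) (T / 2), H (x, y)) (fun x => by simp [h1]) hT]
  ring

theorem HasParity.apply_cos_sin_add_pi {ε : ℕ} {f : ℝ × ℝ → ℂ} (hf : HasParity ε f) (x : ℝ) :
    f (cos (x + π), sin (x + π)) = (-1) ^ ε * f (cos x, sin x) := by
  rw [← hf _ (cos_sin_ne_zero_s6 x), cos_add_pi, sin_add_pi, Prod.neg_mk]

theorem circleIntegrand_add_pi_left {ε : ℕ} {f : ℝ × ℝ → ℂ} (hf : HasParity ε f)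
    (g : ℝ × ℝ → ℂ) (s : ℂ) (x y : ℝ) :
    circleIntegrand f g ε s (x + π, y) = circleIntegrand f g ε s (x, y) := by
  have hsq : ((-1 : ℂ) ^ ε) * (-1) ^ ε = 1 := by rw [← mul_pow]; simp
  simp only [circleIntegrand, hf.apply_cos_sin_add_pi, ← sub_sub, sin_sub_pi, Real.sign_neg,
    abs_neg, Complex.ofReal_neg]
  rw [neg_pow ((Real.sign _ : ℝ) : ℂ)]
  linear_combination (f (cos x, sin x) * g (cos y, sin y) *
    ((Real.sign (sin (y - x)) : ℝ) : ℂ) ^ ε * ((|sin (y - x)| : ℝ) : ℂ) ^ s) * hsq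

theorem circleIntegrand_add_pi_right {ε : ℕ} (f : ℝ × ℝ → ℂ) {g : ℝ × ℝ → ℂ}
    (hg : HasParity ε g) (s : ℂ) (x y : ℝ) :
    circleIntegrand f g ε s (x, y + π) = circleIntegrand f g ε s (x, y) := by
  have hsq : ((-1 : ℂ) ^ ε) * (-1) ^ ε = 1 := by rw [← mul_pow]; simp
  have hsin : sin (y + π - x) = -sin (y - x) := by rw [add_sub_right_comm, sin_add_pi]
  simp only [circleIntegrand, hg.apply_cos_sin_add_pi, hsin, Real.sign_neg, abs_neg,
    Complex.ofReal_neg]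
  rw [neg_pow ((Real.sign _ : ℝ) : ℂ)]
  linear_combination (f (cos x, sin x) * g (cos y, sin y) *
    ((Real.sign (sin (y - x)) : ℝ) : ℂ) ^ ε * ((|sin (y - x)| : ℝ) : ℂ) ^ s) * hsq

/-- for `-1/2 < Re ζ < 0`, `ε ∈ {0,1}`, and `f, g` continuous homogeneous of
degree `2ζ-1`, the double integrals converge absolutely and
`∬_{ℝ²} f(1,t)g(1,u) sgn(u-t)^ε |u-t|^{-1-2ζ} dt du
  = ∬_{(-π/2,π/2)²} f(cos θ, sin θ)g(cos φ, sin φ) sgn(sin(φ-θ))^ε |sin(φ-θ)|^{-1-2ζ} dφ dθ`;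
if moreover `f` and `g` have parity `ε` this also equals
`(1/4) ∬_{(-π,π)²} f(cos θ, sin θ)g(cos φ, sin φ) sgn(sin(φ-θ))^ε |sin(φ-θ)|^{-1-2ζ} dφ dθ`. -/
theorem stmt_6 (ζ : ℂ) (h1 : -(1/2) < ζ.re) (h2 : ζ.re < 0) (ε : ℕ) (hε : ε = 0 ∨ ε = 1)
    (f g : ℝ × ℝ → ℂ)
    (hfc : ContinuousOn f {v : ℝ × ℝ | v ≠ 0}) (hgc : ContinuousOn g {v : ℝ × ℝ | v ≠ 0})
    (hf : IsHomog ζ f) (hg : IsHomog ζ g) :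
    (Integrable (fun p : ℝ × ℝ =>
        f (1, p.1) * g (1, p.2) * ((Real.sign (p.2 - p.1) : ℝ) : ℂ) ^ ε *
          ((|p.2 - p.1| : ℝ) : ℂ) ^ (-1 - 2 * ζ)) ∧
      IntegrableOn (fun q : ℝ × ℝ =>
          f (Real.cos q.1, Real.sin q.1) * g (Real.cos q.2, Real.sin q.2) *
            ((Real.sign (Real.sin (q.2 - q.1)) : ℝ) : ℂ) ^ ε *
            ((|Real.sin (q.2 - q.1)| : ℝ) : ℂ) ^ (-1 - 2 * ζ))
        (Set.Ioo (-(Real.pi/2)) (Real.pi/2) ×ˢ Set.Ioo (-(Real.pi/2)) (Real.pi/2)) ∧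
      (∫ p : ℝ × ℝ,
          f (1, p.1) * g (1, p.2) * ((Real.sign (p.2 - p.1) : ℝ) : ℂ) ^ ε *
            ((|p.2 - p.1| : ℝ) : ℂ) ^ (-1 - 2 * ζ))
        = ∫ q in Set.Ioo (-(Real.pi/2)) (Real.pi/2) ×ˢ Set.Ioo (-(Real.pi/2)) (Real.pi/2),
            f (Real.cos q.1, Real.sin q.1) * g (Real.cos q.2, Real.sin q.2) *
              ((Real.sign (Real.sin (q.2 - q.1)) : ℝ) : ℂ) ^ ε *
              ((|Real.sin (q.2 - q.1)| : ℝ) : ℂ) ^ (-1 - 2 * ζ)) ∧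
    (HasParity ε f → HasParity ε g →
      IntegrableOn (fun q : ℝ × ℝ =>
          f (Real.cos q.1, Real.sin q.1) * g (Real.cos q.2, Real.sin q.2) *
            ((Real.sign (Real.sin (q.2 - q.1)) : ℝ) : ℂ) ^ ε *
            ((|Real.sin (q.2 - q.1)| : ℝ) : ℂ) ^ (-1 - 2 * ζ))
        (Set.Ioo (-Real.pi) Real.pi ×ˢ Set.Ioo (-Real.pi) Real.pi) ∧
      (∫ p : ℝ × ℝ,
          f (1, p.1) * g (1, p.2) * ((Real.sign (p.2 - p.1) : ℝ) : ℂ) ^ ε *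
            ((|p.2 - p.1| : ℝ) : ℂ) ^ (-1 - 2 * ζ))
        = (1/4) * ∫ q in Set.Ioo (-Real.pi) Real.pi ×ˢ Set.Ioo (-Real.pi) Real.pi,
            f (Real.cos q.1, Real.sin q.1) * g (Real.cos q.2, Real.sin q.2) *
              ((Real.sign (Real.sin (q.2 - q.1)) : ℝ) : ℂ) ^ ε *
              ((|Real.sin (q.2 - q.1)| : ℝ) : ℂ) ^ (-1 - 2 * ζ)) := by
  have hs : -1 < (-1 - 2 * ζ).re := by simp; linarith
  have hs' : (-1 - 2 * ζ).re < 0 := by simp; linarith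
  have hbig := integrableOn_circleIntegrand hfc hgc ε hs hs'
  have hsub : Ioo (-(π / 2)) (π / 2) ⊆ Ioo (-π) π :=
    Ioo_subset_Ioo (by linarith [pi_pos]) (by linarith [pi_pos])
  have hsmall := hbig.mono_set (prod_mono hsub hsub)
  have hcov : EqOn (circleIntegrand f g ε (-1 - 2 * ζ))
      (fun q : ℝ × ℝ => (1 / cos q.1 ^ 2 * (1 / cos q.2 ^ 2)) •
        lineIntegrand f g ε (-1 - 2 * ζ) (tan q.1, tan q.2))
      (Ioo (-(π / 2)) (π / 2) ×ˢ Ioo (-(π / 2)) (π / 2)) := fun q hq =>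
    (smul_lineIntegrand_tan hf hg ε (cos_pos_of_mem_Ioo hq.1) (cos_pos_of_mem_Ioo hq.2)).symm
  have hmeas : MeasurableSet (Ioo (-(π / 2)) (π / 2) ×ˢ Ioo (-(π / 2)) (π / 2)) :=
    measurableSet_Ioo.prod measurableSet_Ioo
  have hline : Integrable (lineIntegrand f g ε (-1 - 2 * ζ)) :=
    (integrable_iff_integrableOn_tan _).2 (hsmall.congr_fun hcov hmeas)
  have heq : ∫ p, lineIntegrand f g ε (-1 - 2 * ζ) p =
      ∫ q in Ioo (-(π / 2)) (π / 2) ×ˢ Ioo (-(π / 2)) (π / 2),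
        circleIntegrand f g ε (-1 - 2 * ζ) q :=
    (integral_eq_setIntegral_tan _).trans (setIntegral_congr_fun hmeas hcov).symm
  refine ⟨⟨hline, hsmall, heq⟩, fun hpf hpg => ⟨hbig, heq.trans ?_⟩⟩
  change _ = 1 / 4 * ∫ q in Ioo (-π) π ×ˢ Ioo (-π) π, circleIntegrand f g ε (-1 - 2 * ζ) q
  rw [setIntegral_prod_Ioo_neg_self_of_periodic pi_pos
    (circleIntegrand_add_pi_left hpf g _) (circleIntegrand_add_pi_right f hpg _) hbig]
  ring
end

section
/- Let ζ ∈ ℂ with −1/2 < Re ζ < 0 and ε ∈ {0,1}. Let f, g : ℝ²∖{(0,0)} → ℂ be continuous, homogeneous of degree 2ζ−1, and of parity ε. Then for every x ∈ SL(2,ℝ), ∬_{ℝ×ℝ} f((1,t)·x)·g((1,u)·x)·sgn(u−t)^ε·|u−t|^{−1−2ζ} dt du = ∬_{ℝ×ℝ} f(1,t)·g(1,u)·sgn(u−t)^ε·|u−t|^{−1−2ζ} dt du. -/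
open MeasureTheory

theorem IsHomog.apply_smul {ζ : ℂ} {ε : ℕ} {f : ℝ × ℝ → ℂ} (hf : IsHomog ζ f)
    (hfp : HasParity ε f) {r : ℝ} (hr : r ≠ 0) {v : ℝ × ℝ} (hv : v ≠ 0) :
    f (r • v) = ((Real.sign r : ℝ) : ℂ) ^ ε * ((|r| : ℝ) : ℂ) ^ (2 * ζ - 1) * f v := by
  rcases lt_or_gt_of_ne hr with h | h
  · have h' : r • v = -((-r) • v) := by simp
    rw [h', hfp _ (smul_ne_zero (neg_ne_zero.mpr hr) hv), hf (-r) (neg_pos.mpr h) v hv,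
      Real.sign_of_neg h, abs_of_neg h]
    push_cast
    ring
  · rw [hf r h v hv, Real.sign_of_pos h, abs_of_pos h]
    simp

theorem Real.sign_mul_eq (r s : ℝ) : Real.sign (r * s) = Real.sign r * Real.sign s := by
  rcases lt_trichotomy r 0 with h | rfl | h <;> rcases lt_trichotomy s 0 with h' | rfl | h' <;>
    simp [Real.sign_of_neg, Real.sign_of_pos, mul_pos_of_neg_of_neg, mul_neg_of_neg_of_pos,
      mul_neg_of_pos_of_neg, *]

theorem Real.sign_mul_self_of_ne_zero {r : ℝ} (hr : r ≠ 0) : Real.sign r * Real.sign r = 1 := by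
  rcases Real.sign_apply_eq_of_ne_zero r hr with h | h <;> simp [h]

/-- Removing the zero of a nonzero affine function does not change Lebesgue measure. -/
theorem volume_restrict_affine_ne_zero {p q : ℝ} (h : p ≠ 0 ∨ q ≠ 0) :
    (volume : Measure ℝ).restrict {t : ℝ | p + t * q ≠ 0} = volume := by
  apply Measure.restrict_eq_self_of_ae_mem
  have hs : {t : ℝ | p + t * q = 0}.Subsingleton := by
    intro s hs t ht
    simp only [Set.mem_ofPred_eq] at hs ht
    by_cases hq : q = 0
    · subst hq
      simp_all
    · exact mul_right_cancel₀ hq (by linarith)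
  rw [ae_iff]
  simpa using hs.measure_zero volume

theorem volume_restrict_prod_affine_ne_zero {p q : ℝ} (h : p ≠ 0 ∨ q ≠ 0) :
    (volume : Measure (ℝ × ℝ)).restrict ({t : ℝ | p + t * q ≠ 0} ×ˢ {t : ℝ | p + t * q ≠ 0})
      = volume := by
  rw [Measure.volume_eq_prod, ← Measure.prod_restrict, volume_restrict_affine_ne_zero h]

/-- Change of variables in both coordinates by the same fractional linear transformation. -/
theorem integral_prod_fractional_linear {a b c d : ℝ} (hdet : a * d - b * c = 1)
    (F : ℝ × ℝ → ℂ) :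
    ∫ p, F p = ∫ p : ℝ × ℝ, (((a + p.1 * c) ^ 2)⁻¹ * ((a + p.2 * c) ^ 2)⁻¹) •
      F ((b + p.1 * d) / (a + p.1 * c), (b + p.2 * d) / (a + p.2 * c)) := by
  have hac : a ≠ 0 ∨ c ≠ 0 := by
    by_contra! h
    simp [h.1, h.2] at hdet
  have hdc : d ≠ 0 ∨ -c ≠ 0 := by
    by_contra! h
    simp [h.1, neg_eq_zero.mp h.2] at hdet
  set S : Set ℝ := {t | a + t * c ≠ 0} with hS
  set φ : ℝ → ℝ := fun t ↦ (b + t * d) / (a + t * c) with hφ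
  have hSm : MeasurableSet S := by
    apply IsOpen.measurableSet
    exact isOpen_ne_fun (by fun_prop) (by fun_prop)
  have hinj : Set.InjOn φ S := by
    intro s hs t ht hst
    simp only [hφ] at hst
    rw [div_eq_div_iff hs ht] at hst
    linear_combination hst - (s - t) * hdet
  have himg : φ '' S = {s | d + s * -c ≠ 0} := by
    ext s
    constructor
    · rintro ⟨t, ht, rfl⟩
      have ht' : a + t * c ≠ 0 := ht
      have : d + φ t * -c = 1 / (a + t * c) := by
        simp only [hφ]
        field_simp
        linear_combination hdet
      simpa only [Set.mem_ofPred_eq, this] using one_div_ne_zero ht'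
    · intro hs
      have hs' : d + s * -c ≠ 0 := hs
      have h1 : a + (-b + s * a) / (d + s * -c) * c = 1 / (d + s * -c) := by
        rw [eq_div_iff hs', add_mul, mul_right_comm, div_mul_cancel₀ _ hs']
        linear_combination hdet
      refine ⟨(-b + s * a) / (d + s * -c), ?_, ?_⟩
      · simpa only [hS, Set.mem_ofPred_eq, h1] using one_div_ne_zero hs'
      · simp only [hφ, h1]
        rw [div_div_eq_mul_div, div_one, add_mul, mul_right_comm, div_mul_cancel₀ _ hs']
        linear_combination s * hdet
  have hderiv : ∀ t ∈ S, HasDerivAt φ ((a + t * c) ^ 2)⁻¹ t := by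
    intro t ht
    have h1 : HasDerivAt (fun t : ℝ ↦ b + t * d) d t := by
      simpa using ((hasDerivAt_id t).mul_const d).const_add b
    have h2 : HasDerivAt (fun t : ℝ ↦ a + t * c) c t := by
      simpa using ((hasDerivAt_id t).mul_const c).const_add a
    have h3 : (d * (a + t * c) - (b + t * d) * c) / (a + t * c) ^ 2 = ((a + t * c) ^ 2)⁻¹ := by
      rw [inv_eq_one_div]
      congr 1
      linear_combination hdet
    exact h3 ▸ h1.fun_div h2 ht
  have key := integral_image_eq_integral_abs_det_fderiv_smul (volume : Measure (ℝ × ℝ))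
    (hSm.prod hSm) (f := Prod.map φ φ)
    (f' := fun p ↦ (ContinuousLinearMap.toSpanSingleton ℝ ((a + p.1 * c) ^ 2)⁻¹).prodMap
      (ContinuousLinearMap.toSpanSingleton ℝ ((a + p.2 * c) ^ 2)⁻¹))
    (fun p hp ↦ (HasFDerivAt.prodMap p (hderiv p.1 hp.1).hasFDerivAt
      (hderiv p.2 hp.2).hasFDerivAt).hasFDerivWithinAt)
    (hinj.prodMap hinj) F
  rw [Set.prodMap_image_prod, himg, volume_restrict_prod_affine_ne_zero hdc,
    volume_restrict_prod_affine_ne_zero hac] at key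
  rw [key]
  refine integral_congr_ae (.of_forall fun p ↦ ?_)
  have hd : ∀ r s : ℝ, ((ContinuousLinearMap.toSpanSingleton ℝ r).prodMap
      (ContinuousLinearMap.toSpanSingleton ℝ s)).det = r * s := by
    intro r s
    rw [ContinuousLinearMap.det, ContinuousLinearMap.coe_prodMap, LinearMap.det_prodMap]
    simp [LinearMap.det_ring]
  simp only [hd]
  rw [abs_of_nonneg (by positivity)]
  rfl

/-- for `-1/2 < Re ζ < 0`, `ε ∈ {0,1}`, and `f, g` continuous, homogeneous of
degree `2ζ-1` and of parity `ε`, the bilinear form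
`∬_{ℝ²} f((1,t)·x) g((1,u)·x) sgn(u-t)^ε |u-t|^{-1-2ζ} dt du` is independent of
`x ∈ SL(2,ℝ)`. -/
theorem stmt_7 (ζ : ℂ) (h1 : -(1/2) < ζ.re) (h2 : ζ.re < 0) (ε : ℕ) (hε : ε = 0 ∨ ε = 1)
    (f g : ℝ × ℝ → ℂ)
    (hfc : ContinuousOn f {v : ℝ × ℝ | v ≠ 0}) (hgc : ContinuousOn g {v : ℝ × ℝ | v ≠ 0})
    (hf : IsHomog ζ f) (hg : IsHomog ζ g)
    (hfp : HasParity ε f) (hgp : HasParity ε g) :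
    ∀ x : Matrix.SpecialLinearGroup (Fin 2) ℝ,
      (∫ p : ℝ × ℝ,
          f (rowAct x (1, p.1)) * g (rowAct x (1, p.2)) *
            ((Real.sign (p.2 - p.1) : ℝ) : ℂ) ^ ε *
            ((|p.2 - p.1| : ℝ) : ℂ) ^ (-1 - 2 * ζ))
        = ∫ p : ℝ × ℝ,
            f (1, p.1) * g (1, p.2) * ((Real.sign (p.2 - p.1) : ℝ) : ℂ) ^ ε *
              ((|p.2 - p.1| : ℝ) : ℂ) ^ (-1 - 2 * ζ) := by
  intro x
  have hdet : x.1 0 0 * x.1 1 1 - x.1 0 1 * x.1 1 0 = 1 := by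
    rw [← Matrix.det_fin_two, x.2]
  have hac : x.1 0 0 ≠ 0 ∨ x.1 1 0 ≠ 0 := by
    by_contra! h
    simp [h.1, h.2] at hdet
  symm
  rw [integral_prod_fractional_linear hdet]
  symm
  have hae : ∀ᵐ p : ℝ × ℝ, p ∈ {t : ℝ | x.1 0 0 + t * x.1 1 0 ≠ 0} ×ˢ
      {t : ℝ | x.1 0 0 + t * x.1 1 0 ≠ 0} := by
    rw [← volume_restrict_prod_affine_ne_zero hac]
    refine ae_restrict_mem (MeasurableSet.prod ?_ ?_) <;>
      exact (isOpen_ne_fun (by fun_prop) (by fun_prop)).measurableSet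
  refine integral_congr_ae ?_
  filter_upwards [hae] with ⟨t, u⟩ ⟨ht, hu⟩
  have hrow : ∀ s : ℝ, x.1 0 0 + s * x.1 1 0 ≠ 0 → rowAct x (1, s) =
      (x.1 0 0 + s * x.1 1 0) •
        ((1, (x.1 0 1 + s * x.1 1 1) / (x.1 0 0 + s * x.1 1 0)) : ℝ × ℝ) := by
    intro s hs
    ext
    · simp [rowAct]
    · simp only [rowAct, Prod.smul_mk, smul_eq_mul]
      field_simp
  have hsub : u - t = (x.1 0 0 + t * x.1 1 0) * (x.1 0 0 + u * x.1 1 0) *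
      ((x.1 0 1 + u * x.1 1 1) / (x.1 0 0 + u * x.1 1 0) -
        (x.1 0 1 + t * x.1 1 1) / (x.1 0 0 + t * x.1 1 0)) := by
    simp only [Set.mem_ofPred_eq] at ht hu
    field_simp
    linear_combination (t - u) * hdet
  simp only [Set.mem_ofPred_eq] at ht hu
  simp only [hrow t ht, hrow u hu]
  rw [hf.apply_smul hfp ht (by simp), hg.apply_smul hgp hu (by simp), hsub]
  generalize x.1 0 0 + t * x.1 1 0 = r at *
  generalize x.1 0 0 + u * x.1 1 0 = s at *
  generalize (x.1 0 1 + t * x.1 1 1) / r = t'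
  generalize (x.1 0 1 + u * x.1 1 1) / s = u'
  rw [Real.sign_mul_eq, Real.sign_mul_eq, abs_mul, abs_mul]
  push_cast
  rw [← Complex.ofReal_mul |r| |s|, Complex.mul_cpow_ofReal_nonneg (by positivity) (by positivity),
    Complex.ofReal_mul, Complex.mul_cpow_ofReal_nonneg (by positivity) (by positivity)]
  have hsign : ∀ r : ℝ, r ≠ 0 →
      ((Real.sign r : ℝ) : ℂ) ^ ε * ((Real.sign r : ℝ) : ℂ) ^ ε = 1 := by
    intro r hr
    rw [← mul_pow, ← Complex.ofReal_mul, Real.sign_mul_self_of_ne_zero hr]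
    simp
  have hpow : ∀ r : ℝ, r ≠ 0 → ((|r| : ℝ) : ℂ) ^ (2 * ζ - 1) * ((|r| : ℝ) : ℂ) ^ (-1 - 2 * ζ) =
      ((r : ℂ) ^ 2)⁻¹ := by
    intro r hr
    rw [← Complex.cpow_add _ _ (by simpa using hr), show 2 * ζ - 1 + (-1 - 2 * ζ) = -(2 : ℕ) by
      push_cast; ring, Complex.cpow_neg, Complex.cpow_natCast, ← Complex.ofReal_pow, sq_abs]
    push_cast
    rfl
  rw [Complex.real_smul]
  push_cast
  rw [← hpow r ht, ← hpow s hu, mul_pow, mul_pow]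
  set A := ((Real.sign r : ℝ) : ℂ) ^ ε
  set B := ((Real.sign s : ℝ) : ℂ) ^ ε
  have hA : A * A = 1 := hsign r ht
  have hB : B * B = 1 := hsign s hu
  generalize ((|r| : ℝ) : ℂ) ^ (2 * ζ - 1) = R₁
  generalize ((|r| : ℝ) : ℂ) ^ (-1 - 2 * ζ) = R₂
  generalize ((|s| : ℝ) : ℂ) ^ (2 * ζ - 1) = S₁
  generalize ((|s| : ℝ) : ℂ) ^ (-1 - 2 * ζ) = S₂
  generalize ((|u' - t'| : ℝ) : ℂ) ^ (-1 - 2 * ζ) = K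
  generalize ((Real.sign (u' - t') : ℝ) : ℂ) ^ ε = E
  linear_combination (R₁ * R₂ * S₁ * S₂ * f (1, t') * g (1, u') * E * K) * (B * B * hA + hB)
end

section
/- Let ε ∈ {0,1}, let μ ∈ ℤ with μ ≡ ε (mod 2), and let ζ ∈ ℂ with −1/2 < Re ζ < 0. Set b(ζ,μ) = σ(μ,ε)·2^{1+2ζ}·π·Γ(−2ζ)/(Γ(1/2−ζ+μ/2)·Γ(1/2−ζ−μ/2)) with σ(μ,ε) = (1−ε)·cos(μπ/2) + i·ε·sin(μπ/2), and set c(ζ,ε) = i^ε·π^{1/2}·2^{−2ζ}·Γ(ε/2−ζ)/Γ(1/2+ε/2+ζ). Then b(ζ,μ)/c(ζ,ε) = 2^{2ζ}·Γ(1/2+ζ+μ/2)/Γ(1/2−ζ+μ/2). -/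
open Complex in
theorem Complex.Gamma_mul_Gamma_one_sub_add_int (s : ℂ) (k : ℤ) :
    Gamma s * Gamma (1 - s) = (-1) ^ k * (Gamma (s + k) * Gamma (1 - (s + k))) := by
  rw [Gamma_mul_Gamma_one_sub, Gamma_mul_Gamma_one_sub, mul_add, mul_comm (Real.pi : ℂ) (k : ℂ),
    show sin (Real.pi * s + k * Real.pi) = (-1) ^ k * sin (Real.pi * s) from
      k.cast_negOnePow ℂ ▸ sin_antiperiodic.add_int_mul_eq k]
  have h : ((-1 : ℂ) ^ k) ≠ 0 := zpow_ne_zero k (by norm_num)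
  rw [← mul_div_assoc, mul_div_mul_left _ _ h]

theorem Complex.Gamma_ne_zero_of_re_mem_Ioo {s : ℂ} (k : ℤ) (h₁ : (k : ℝ) < s.re)
    (h₂ : s.re < k + 1) : Complex.Gamma s ≠ 0 := by
  refine Complex.Gamma_ne_zero fun m hm => ?_
  have hre : s.re = ((-m : ℤ) : ℝ) := by simp [hm]
  rw [hre] at h₁ h₂
  norm_cast at h₁ h₂
  omega

/-- for `ε ∈ {0,1}`, `μ ≡ ε (mod 2)`, `-1/2 < Re ζ < 0`, with
`b(ζ,μ) = σ(μ,ε) 2^{1+2ζ} π Γ(-2ζ)/(Γ(1/2-ζ+μ/2) Γ(1/2-ζ-μ/2))`,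
`σ(μ,ε) = (1-ε)cos(μπ/2) + iε sin(μπ/2)`, and
`c(ζ,ε) = i^ε π^{1/2} 2^{-2ζ} Γ(ε/2-ζ)/Γ(1/2+ε/2+ζ)`, one has
`b(ζ,μ)/c(ζ,ε) = 2^{2ζ} Γ(1/2+ζ+μ/2)/Γ(1/2-ζ+μ/2)`. -/
theorem stmt_9 (ε : ℕ) (hε : ε = 0 ∨ ε = 1) (μ : ℤ) (hμ : μ % 2 = (ε : ℤ))
    (ζ : ℂ) (h1 : -(1/2) < ζ.re) (h2 : ζ.re < 0) :
    ((((1 : ℂ) - (ε : ℂ)) * ((Real.cos ((μ : ℝ) * Real.pi / 2) : ℝ) : ℂ)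
          + Complex.I * (ε : ℂ) * ((Real.sin ((μ : ℝ) * Real.pi / 2) : ℝ) : ℂ)) *
        (2 : ℂ) ^ (1 + 2 * ζ) * (Real.pi : ℂ) * Complex.Gamma (-2 * ζ) /
        (Complex.Gamma (1/2 - ζ + (μ : ℂ)/2) * Complex.Gamma (1/2 - ζ - (μ : ℂ)/2))) /
      (Complex.I ^ ε * (Real.pi : ℂ) ^ ((1 : ℂ)/2) * (2 : ℂ) ^ (-2 * ζ) *
        Complex.Gamma ((ε : ℂ)/2 - ζ) / Complex.Gamma (1/2 + (ε : ℂ)/2 + ζ))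
      = (2 : ℂ) ^ (2 * ζ) * Complex.Gamma (1/2 + ζ + (μ : ℂ)/2) /
          Complex.Gamma (1/2 - ζ + (μ : ℂ)/2) := by
  have hpi : (Real.pi : ℂ) ^ ((1 : ℂ) / 2) ≠ 0 := by
    simp [Complex.cpow_eq_zero_iff, Real.pi_ne_zero]
  have hpi_sq : (Real.pi : ℂ) = (Real.pi : ℂ) ^ ((1 : ℂ) / 2) * (Real.pi : ℂ) ^ ((1 : ℂ) / 2) := by
    rw [← Complex.cpow_add _ _ (by simp [Real.pi_ne_zero])]
    norm_num
  have hsqrt : ((Real.sqrt Real.pi : ℝ) : ℂ) = (Real.pi : ℂ) ^ ((1 : ℂ) / 2) := by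
    rw [Real.sqrt_eq_rpow, Complex.ofReal_cpow Real.pi_pos.le]
    norm_num
  have htwo : (2 : ℂ) ^ (2 * ζ) ≠ 0 := by simp [Complex.cpow_eq_zero_iff]
  have htwo_neg : (2 : ℂ) ^ (-2 * ζ) = ((2 : ℂ) ^ (2 * ζ))⁻¹ := by
    rw [← Complex.cpow_neg]
    ring_nf
  have hdup : (2 : ℂ) ^ (1 + 2 * ζ) * (Real.pi : ℂ) * Complex.Gamma (-2 * ζ) =
      (Real.pi : ℂ) ^ ((1 : ℂ) / 2) * (Complex.Gamma (-ζ) * Complex.Gamma (1 / 2 - ζ)) := by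
    have h := Complex.Gamma_mul_Gamma_add_half (-ζ)
    rw [hsqrt, show -ζ + 1 / 2 = 1 / 2 - ζ by ring, show 2 * -ζ = -2 * ζ by ring,
      show 1 - -2 * ζ = 1 + 2 * ζ by ring] at h
    rw [h]
    linear_combination (2 : ℂ) ^ (1 + 2 * ζ) * Complex.Gamma (-2 * ζ) * hpi_sq
  have hneg : Complex.Gamma (-ζ) ≠ 0 :=
    Complex.Gamma_ne_zero_of_re_pos (by simpa using h2)
  have hhalf : Complex.Gamma (1 / 2 - ζ) ≠ 0 :=
    Complex.Gamma_ne_zero_of_re_pos (by norm_num; linarith)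
  rw [mul_assoc, mul_assoc, ← mul_assoc ((2 : ℂ) ^ (1 + 2 * ζ)), hdup, htwo_neg]
  obtain ⟨k, hk⟩ : ∃ k : ℤ, μ = 2 * k + ε := ⟨μ / 2, by omega⟩
  have hsign : ((-1 : ℂ) ^ k) * (-1) ^ k = 1 := by
    rw [← mul_zpow]
    simp
  rcases hε with rfl | rfl
  · have hcos : Real.cos ((μ : ℝ) * Real.pi / 2) = (-1) ^ k := by
      rw [hk, ← Real.cos_int_mul_pi]
      congr 1
      push_cast
      ring
    have hμk : (μ : ℂ) / 2 = k := by
      rw [hk]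
      push_cast
      ring
    have hden : Complex.Gamma (1 / 2 - ζ - k) ≠ 0 :=
      Complex.Gamma_ne_zero_of_re_mem_Ioo (-k) (by norm_num; linarith) (by norm_num; linarith)
    have hrefl := Complex.Gamma_mul_Gamma_one_sub_add_int (1 / 2 + ζ) k
    rw [show 1 - (1 / 2 + ζ) = 1 / 2 - ζ by ring,
      show 1 - (1 / 2 + ζ + k) = 1 / 2 - ζ - k by ring] at hrefl
    rw [hcos, hμk]
    simp only [Nat.cast_zero, zero_div, zero_sub, add_zero, pow_zero, sub_zero, mul_zero, zero_mul,
      one_mul]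
    push_cast
    generalize Complex.Gamma (1 / 2 - ζ + k) = D
    generalize Complex.Gamma (1 / 2 - ζ) = A at *
    generalize Complex.Gamma (1 / 2 + ζ) = B at *
    generalize Complex.Gamma (1 / 2 - ζ - k) = E at *
    generalize Complex.Gamma (1 / 2 + ζ + k) = F at *
    field_simp
    linear_combination D⁻¹ * ((-1) ^ k * hrefl + F * E * hsign)
  · have hsin : Real.sin ((μ : ℝ) * Real.pi / 2) = (-1) ^ k := by
      rw [hk, ← Real.cos_int_mul_pi, ← Real.sin_add_pi_div_two]
      congr 1
      push_cast
      ring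
    have hμk : (μ : ℂ) / 2 = k + 1 / 2 := by
      rw [hk]
      push_cast
      ring
    have hden : Complex.Gamma (-ζ - k) ≠ 0 :=
      Complex.Gamma_ne_zero_of_re_mem_Ioo (-k) (by norm_num; linarith) (by norm_num; linarith)
    have hrefl := Complex.Gamma_mul_Gamma_one_sub_add_int (1 + ζ) k
    rw [show 1 - (1 + ζ) = -ζ by ring, show 1 - (1 + ζ + k) = -ζ - k by ring] at hrefl
    rw [hsin, hμk, show 1 / 2 - ζ - (k + 1 / 2 : ℂ) = -ζ - k by ring,
      show 1 / 2 + ζ + (k + 1 / 2 : ℂ) = 1 + ζ + k by ring]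
    simp only [Nat.cast_one, sub_self, zero_mul, zero_add, mul_one, pow_one, add_halves]
    push_cast
    generalize Complex.Gamma (1 / 2 - ζ + (k + 1 / 2)) = D
    generalize Complex.Gamma (1 / 2 - ζ) = A at *
    field_simp
    linear_combination D⁻¹ * ((-1) ^ k * hrefl +
      Complex.Gamma (1 + ζ + k) * Complex.Gamma (-ζ - k) * hsign)
end

section
/- Let ε ∈ {0,1}, let μ ∈ ℤ with μ ≡ ε (mod 2), let κ be an even integer, and let η ∈ ℝ∖{0}. Then (1/(2π))·∫_{−π}^{π} sgn(cos θ)^ε·|cos θ|^{−2iη}·e^{−i(κ−μ)θ} dθ = 2^{2iη}·Γ(1−2iη)/(Γ(1−iη+(κ−μ)/2)·Γ(1−iη−(κ−μ)/2)). -/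
open MeasureTheory

/-- The image of `(-π/2, π/2)` under `θ ↦ (1 + sin θ) / 2` is `(0, 1)`. -/
lemma image_one_add_sin_div_two :
    (fun θ : ℝ => (1 + Real.sin θ) / 2) '' Set.Ioo (-(Real.pi / 2)) (Real.pi / 2) =
      Set.Ioo 0 1 := by
  ext x
  constructor
  · rintro ⟨θ, hθ, rfl⟩
    have h := Real.cos_pos_of_mem_Ioo hθ
    have h2 := Real.sin_sq_add_cos_sq θ
    constructor <;> dsimp only <;> nlinarith
  · rintro ⟨h0, h1⟩
    refine ⟨Real.arcsin (2 * x - 1), ⟨?_, ?_⟩, ?_⟩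
    · exact Real.neg_pi_div_two_lt_arcsin.2 (by linarith)
    · exact Real.arcsin_lt_pi_div_two.2 (by linarith)
    · dsimp only
      rw [Real.sin_arcsin (by linarith) (by linarith)]
      ring

/-- Half-period cosine integrals as values of the beta integral. -/
lemma integral_cos_cpow_eq_betaIntegral (s : ℂ) :
    ∫ θ in (-(Real.pi / 2))..(Real.pi / 2), ((Real.cos θ : ℝ) : ℂ) ^ s =
      2 ^ s * Complex.betaIntegral ((s + 1) / 2) ((s + 1) / 2) := by
  have hpi := Real.pi_pos
  have hinj : Set.InjOn (fun θ : ℝ => (1 + Real.sin θ) / 2)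
      (Set.Ioo (-(Real.pi / 2)) (Real.pi / 2)) := by
    intro x hx y hy hxy
    refine Real.injOn_sin (Set.Ioo_subset_Icc_self hx) (Set.Ioo_subset_Icc_self hy) ?_
    dsimp only at hxy
    linarith
  have hderiv : ∀ θ ∈ Set.Ioo (-(Real.pi / 2)) (Real.pi / 2),
      HasDerivWithinAt (fun θ : ℝ => (1 + Real.sin θ) / 2) (Real.cos θ / 2)
        (Set.Ioo (-(Real.pi / 2)) (Real.pi / 2)) θ := fun θ _ =>
    (((Real.hasDerivAt_sin θ).const_add 1).div_const 2).hasDerivWithinAt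
  have key := integral_image_eq_integral_abs_deriv_smul measurableSet_Ioo hderiv hinj
    (fun x : ℝ => (x : ℂ) ^ ((s + 1) / 2 - 1) * (1 - (x : ℂ)) ^ ((s + 1) / 2 - 1))
  rw [image_one_add_sin_div_two] at key
  rw [Complex.betaIntegral, intervalIntegral.integral_of_le zero_le_one,
    integral_Ioc_eq_integral_Ioo, key, intervalIntegral.integral_of_le (by linarith),
    integral_Ioc_eq_integral_Ioo, ← integral_const_mul]
  refine setIntegral_congr_fun measurableSet_Ioo fun θ hθ => ?_
  have hc := Real.cos_pos_of_mem_Ioo hθ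
  have h2 := Real.sin_sq_add_cos_sq θ
  have hd : (0 : ℝ) < Real.cos θ / 2 := by linarith
  have hd' : ((Real.cos θ / 2 : ℝ) : ℂ) ≠ 0 := by exact_mod_cast hd.ne'
  have e1 : (1 : ℂ) - (((1 + Real.sin θ) / 2 : ℝ) : ℂ) = (((1 - Real.sin θ) / 2 : ℝ) : ℂ) := by
    push_cast; ring
  have e2 : (((1 + Real.sin θ) / 2 : ℝ) : ℂ) * (((1 - Real.sin θ) / 2 : ℝ) : ℂ) =
      ((Real.cos θ / 2 : ℝ) : ℂ) * ((Real.cos θ / 2 : ℝ) : ℂ) := by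
    norm_cast
    nlinarith
  have e3 : ((Real.cos θ : ℝ) : ℂ) = ((2 : ℝ) : ℂ) * ((Real.cos θ / 2 : ℝ) : ℂ) := by
    push_cast; ring
  rw [e1, ← Complex.mul_cpow_ofReal_nonneg (by nlinarith) (by nlinarith), e2,
    Complex.mul_cpow_ofReal_nonneg hd.le hd.le, abs_of_pos hd, Complex.real_smul, e3,
    Complex.mul_cpow_ofReal_nonneg zero_le_two hd.le, ← Complex.cpow_add _ _ hd']
  nth_rewrite 2 [← Complex.cpow_one ((Real.cos θ / 2 : ℝ) : ℂ)]
  rw [← Complex.cpow_add _ _ hd', Complex.ofReal_ofNat]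
  congr 2
  ring

lemma intervalIntegrable_cos_cpow_mul {s : ℂ} (hs : 0 ≤ s.re) {g : ℝ → ℂ} (hg : Continuous g) :
    IntervalIntegrable (fun θ : ℝ => ((Real.cos θ : ℝ) : ℂ) ^ s * g θ) volume
      (-(Real.pi / 2)) (Real.pi / 2) := by
  have hpi := Real.pi_pos
  refine IntervalIntegrable.mul_continuousOn ?_ hg.continuousOn
  rw [intervalIntegrable_iff_integrableOn_Ioo_of_le (by linarith)]
  refine Measure.integrableOn_of_bounded (M := 1) (by simp) ?_ ?_
  · exact ((Complex.measurable_ofReal.comp Real.measurable_cos).pow_const s).aestronglyMeasurable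
  · refine (ae_restrict_iff' measurableSet_Ioo).2 (Filter.Eventually.of_forall fun θ hθ => ?_)
    have hc := Real.cos_pos_of_mem_Ioo hθ
    rw [Complex.norm_cpow_eq_rpow_re_of_pos hc]
    exact Real.rpow_le_one hc.le (Real.cos_le_one θ) hs

/-- The Fourier-type integral `∫ cos^s θ e^{-imθ} dθ` over `[-π/2, π/2]`. -/
noncomputable def cosFourier (s m : ℂ) : ℂ :=
  ∫ θ in (-(Real.pi / 2))..(Real.pi / 2),
    ((Real.cos θ : ℝ) : ℂ) ^ s * Complex.exp (-(m * (θ : ℂ)) * Complex.I)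

lemma cosFourier_neg (s m : ℂ) : cosFourier s (-m) = cosFourier s m := by
  have h := intervalIntegral.integral_comp_neg (a := -(Real.pi / 2)) (b := Real.pi / 2)
    (fun θ : ℝ => ((Real.cos θ : ℝ) : ℂ) ^ s * Complex.exp (-(m * (θ : ℂ)) * Complex.I))
  rw [neg_neg] at h
  rw [cosFourier, cosFourier, ← h]
  simp

lemma cosFourier_recurrence {s : ℂ} (hs : 0 ≤ s.re) (a : ℂ) :
    (s + 1 + a) * cosFourier s (a + 1) = (s + 1 - a) * cosFourier s (a - 1) := by
  have hpi := Real.pi_pos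
  have hs1 : 0 < (s + 1).re := by simp; linarith
  have hs0 : s + 1 ≠ 0 := fun h => by simp [h] at hs1
  have hint : ∀ m : ℂ, IntervalIntegrable (fun θ : ℝ => ((Real.cos θ : ℝ) : ℂ) ^ s *
      Complex.exp (-(m * (θ : ℂ)) * Complex.I)) volume (-(Real.pi / 2)) (Real.pi / 2) :=
    fun m => intervalIntegrable_cos_cpow_mul hs (by fun_prop)
  have hcont : Continuous (fun θ : ℝ => ((Real.cos θ : ℝ) : ℂ) ^ (s + 1) *
      Complex.exp (-(a * (θ : ℂ)) * Complex.I)) :=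
    ((Complex.continuous_ofReal_cpow_const hs1).comp Real.continuous_cos).mul (by fun_prop)
  have key := intervalIntegral.integral_eq_sub_of_hasDerivAt_of_le
    (a := -(Real.pi / 2)) (b := Real.pi / 2)
    (f := fun θ : ℝ => ((Real.cos θ : ℝ) : ℂ) ^ (s + 1) *
      Complex.exp (-(a * (θ : ℂ)) * Complex.I))
    (f' := fun θ : ℝ => Complex.I / 2 * (s + 1 - a) * (((Real.cos θ : ℝ) : ℂ) ^ s *
        Complex.exp (-((a - 1) * (θ : ℂ)) * Complex.I)) -
      Complex.I / 2 * (s + 1 + a) * (((Real.cos θ : ℝ) : ℂ) ^ s *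
        Complex.exp (-((a + 1) * (θ : ℂ)) * Complex.I)))
    (by linarith) hcont.continuousOn ?_
    (((hint _).const_mul _).sub ((hint _).const_mul _))
  · rw [intervalIntegral.integral_sub ((hint _).const_mul _) ((hint _).const_mul _),
      intervalIntegral.integral_const_mul, intervalIntegral.integral_const_mul] at key
    simp only [Real.cos_neg, Real.cos_pi_div_two, Complex.ofReal_zero,
      Complex.zero_cpow hs0, zero_mul, sub_zero] at key
    change _ * cosFourier s (a - 1) - _ * cosFourier s (a + 1) = 0 at key
    have hI := Complex.I_ne_zero
    refine mul_left_cancel₀ (div_ne_zero hI two_ne_zero) ?_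
    linear_combination -key
  · intro θ hθ
    have hc := Real.cos_pos_of_mem_Ioo hθ
    have hc' : Complex.cos (θ : ℂ) ≠ 0 := by
      rw [← Complex.ofReal_cos]; exact_mod_cast hc.ne'
    have hslit : Complex.cos (θ : ℂ) ∈ Complex.slitPlane := by
      rw [← Complex.ofReal_cos]; exact Complex.ofReal_mem_slitPlane.2 hc
    have h1 := ((Complex.hasDerivAt_cos (θ : ℂ)).cpow_const (c := s + 1) hslit)
    have h2 : HasDerivAt (fun z : ℂ => Complex.exp (-(a * z) * Complex.I))
        (Complex.exp (-(a * (θ : ℂ)) * Complex.I) * (-(a * 1) * Complex.I)) (θ : ℂ) :=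
      ((((hasDerivAt_id (θ : ℂ)).const_mul a).neg).mul_const Complex.I).cexp
    have h3 := (h1.mul h2).comp_ofReal
    simp only [Complex.ofReal_cos]
    refine h3.congr_deriv ?_
    symm
    have em : Complex.exp (-((a - 1) * (θ : ℂ)) * Complex.I) =
        Complex.exp (-(a * (θ : ℂ)) * Complex.I) *
          (Complex.cos θ + Complex.sin θ * Complex.I) := by
      rw [← Complex.exp_mul_I, ← Complex.exp_add]; ring_nf
    have ep : Complex.exp (-((a + 1) * (θ : ℂ)) * Complex.I) =
        Complex.exp (-(a * (θ : ℂ)) * Complex.I) *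
          (Complex.cos θ - Complex.sin θ * Complex.I) := by
      have : Complex.cos θ - Complex.sin θ * Complex.I =
          Complex.cos (-θ) + Complex.sin (-θ) * Complex.I := by
        rw [Complex.cos_neg, Complex.sin_neg]; ring
      rw [this, ← Complex.exp_mul_I, ← Complex.exp_add]; ring_nf
    rw [em, ep, add_sub_cancel_right, Complex.cpow_add _ _ hc', Complex.cpow_one]
    ring_nf
    rw [Complex.I_sq]
    ring

/-- The closed form of `cosFourier`. -/
noncomputable def cosFourierGamma (s m : ℂ) : ℂ :=
  Real.pi * Complex.Gamma (1 + s) * 2 ^ (-s) *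
    ((Complex.Gamma (1 + s / 2 + m / 2))⁻¹ * (Complex.Gamma (1 + s / 2 - m / 2))⁻¹)

lemma cosFourierGamma_neg (s m : ℂ) : cosFourierGamma s (-m) = cosFourierGamma s m := by
  unfold cosFourierGamma
  ring_nf

lemma cosFourierGamma_recurrence (s m : ℂ) :
    (s + 2 + m) * cosFourierGamma s (m + 2) = (s - m) * cosFourierGamma s m := by
  have h1 := Complex.one_div_Gamma_eq_self_mul_one_div_Gamma_add_one (1 + s / 2 + m / 2)
  have h2 := Complex.one_div_Gamma_eq_self_mul_one_div_Gamma_add_one (s / 2 - m / 2)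
  unfold cosFourierGamma
  rw [show 1 + s / 2 + (m + 2) / 2 = 1 + s / 2 + m / 2 + 1 by ring,
    show 1 + s / 2 - (m + 2) / 2 = s / 2 - m / 2 by ring, h1, h2,
    show s / 2 - m / 2 + 1 = 1 + s / 2 - m / 2 by ring]
  ring

lemma integral_cos_cpow_eq_Gamma {s : ℂ} (hs : -1 < s.re) :
    ∫ θ in (-(Real.pi / 2))..(Real.pi / 2), ((Real.cos θ : ℝ) : ℂ) ^ s =
      2 ^ s * (Complex.Gamma ((s + 1) / 2) ^ 2 / Complex.Gamma (s + 1)) := by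
  have h : 0 < ((s + 1) / 2).re := by simp; linarith
  have h0 : 0 < (s + 1).re := by simp; linarith
  have hG := Complex.Gamma_ne_zero_of_re_pos h0
  have hb := Complex.Gamma_mul_Gamma_eq_betaIntegral h h
  rw [add_halves] at hb
  rw [integral_cos_cpow_eq_betaIntegral, eq_comm]
  congr 1
  rw [div_eq_iff hG]
  linear_combination hb

lemma Gamma_half_mul_Gamma (s : ℂ) :
    (Complex.Gamma ((s + 1) / 2) * Complex.Gamma (1 + s / 2)) ^ 2 * 2 ^ s * 2 ^ s =
      Complex.Gamma (1 + s) ^ 2 * Real.pi := by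
  have h := Complex.Gamma_mul_Gamma_add_half ((s + 1) / 2)
  rw [show (s + 1) / 2 + 1 / 2 = 1 + s / 2 by ring, show 2 * ((s + 1) / 2) = 1 + s by ring,
    show 1 - (1 + s) = -s by ring, Complex.cpow_neg] at h
  have h2 : (2 : ℂ) ^ s ≠ 0 := by simp [Complex.cpow_eq_zero_iff]
  have hp : ((√Real.pi : ℝ) : ℂ) ^ 2 = Real.pi := by
    exact_mod_cast Real.sq_sqrt Real.pi_pos.le
  rw [h, ← hp]
  field_simp

lemma cosFourier_zero {s : ℂ} (hs : 0 ≤ s.re) : cosFourier s 0 = cosFourierGamma s 0 := by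
  have h1 : Complex.Gamma (1 + s) ≠ 0 := Complex.Gamma_ne_zero_of_re_pos (by simp; linarith)
  have h2 : Complex.Gamma (1 + s / 2) ≠ 0 := Complex.Gamma_ne_zero_of_re_pos (by simp; linarith)
  have h3 : (2 : ℂ) ^ s ≠ 0 := by simp [Complex.cpow_eq_zero_iff]
  have hG := Gamma_half_mul_Gamma s
  have hI := integral_cos_cpow_eq_Gamma (s := s) (by linarith)
  have : cosFourier s 0 =
      ∫ θ in (-(Real.pi / 2))..(Real.pi / 2), ((Real.cos θ : ℝ) : ℂ) ^ s := by
    simp [cosFourier]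
  rw [this, hI, cosFourierGamma, Complex.cpow_neg, zero_div, add_zero, sub_zero, add_comm s 1]
  rw [add_comm s 1] at hG
  generalize Complex.Gamma (1 + s / 2) = G at *
  field_simp
  linear_combination hG

lemma cosFourier_one {s : ℂ} (hs : 0 ≤ s.re) : cosFourier s 1 = cosFourierGamma s 1 := by
  have hpi := Real.pi_pos
  have hs0 : s + 1 ≠ 0 := fun h => by
    have := congrArg Complex.re h
    simp at this
    linarith
  have h1 : Complex.Gamma (1 + s) ≠ 0 := Complex.Gamma_ne_zero_of_re_pos (by simp; linarith)
  have h2 : Complex.Gamma ((1 + s) / 2) ≠ 0 :=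
    Complex.Gamma_ne_zero_of_re_pos (by simp; linarith)
  have h3 : (2 : ℂ) ^ s ≠ 0 := by simp [Complex.cpow_eq_zero_iff]
  have hG := Gamma_half_mul_Gamma s
  have hI := integral_cos_cpow_eq_Gamma (s := s + 1) (by simp; linarith)
  have hint : ∀ m : ℂ, IntervalIntegrable (fun θ : ℝ => ((Real.cos θ : ℝ) : ℂ) ^ s *
      Complex.exp (-(m * (θ : ℂ)) * Complex.I)) volume (-(Real.pi / 2)) (Real.pi / 2) :=
    fun m => intervalIntegrable_cos_cpow_mul hs (by fun_prop)
  have hsum : 2 * cosFourier s 1 = 2 * ∫ θ in (-(Real.pi / 2))..(Real.pi / 2),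
      ((Real.cos θ : ℝ) : ℂ) ^ (s + 1) := by
    rw [two_mul]
    nth_rewrite 2 [← cosFourier_neg]
    rw [cosFourier, cosFourier, ← intervalIntegral.integral_add (hint _) (hint _),
      ← intervalIntegral.integral_const_mul]
    refine intervalIntegral.integral_congr_Ioo_of_le (by linarith) fun θ hθ => ?_
    have hc : ((Real.cos θ : ℝ) : ℂ) ≠ 0 := by
      exact_mod_cast (Real.cos_pos_of_mem_Ioo hθ).ne'
    rw [Complex.cpow_add _ _ hc, Complex.cpow_one]
    nth_rewrite 4 [Complex.ofReal_cos]
    rw [Complex.cos]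
    ring_nf
  have hsum' := mul_left_cancel₀ two_ne_zero hsum
  rw [hsum', hI, cosFourierGamma, Complex.cpow_neg, Complex.Gamma_add_one _ hs0,
    show 1 + s / 2 + 1 / 2 = (1 + s) / 2 + 1 by ring,
    show 1 + s / 2 - 1 / 2 = (1 + s) / 2 by ring,
    show (s + 1 + 1) / 2 = 1 + s / 2 by ring,
    Complex.Gamma_add_one _ (div_ne_zero (by rwa [add_comm]) two_ne_zero),
    Complex.cpow_add _ _ two_ne_zero, Complex.cpow_one, add_comm s 1]
  rw [add_comm s 1] at hG hs0
  generalize Complex.Gamma (1 + s / 2) = G at *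
  field_simp
  linear_combination hG

lemma cosFourier_natCast {s : ℂ} (hs : 0 ≤ s.re) (n : ℕ) :
    cosFourier s n = cosFourierGamma s n := by
  induction n using Nat.twoStepInduction with
  | zero => simpa using cosFourier_zero hs
  | one => simpa using cosFourier_one hs
  | more n ih _ =>
    have h0 : s + 2 + n ≠ 0 := fun h => by
      have := congrArg Complex.re h
      simp at this
      have hn : (0 : ℝ) ≤ n := n.cast_nonneg
      linarith
    have h1 := cosFourier_recurrence hs (n + 1)
    have h2 := cosFourierGamma_recurrence s n
    rw [add_sub_cancel_right, add_assoc (n : ℂ), one_add_one_eq_two, ih] at h1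
    push_cast
    refine mul_left_cancel₀ h0 ?_
    rw [h2]
    linear_combination h1

/-- Cauchy's formula for `∫ cos^s θ e^{-imθ} dθ`, `m` an integer. -/
lemma cosFourier_intCast {s : ℂ} (hs : 0 ≤ s.re) (m : ℤ) :
    cosFourier s m = cosFourierGamma s m := by
  obtain ⟨n, rfl | rfl⟩ := m.eq_nat_or_neg
  · exact_mod_cast cosFourier_natCast hs n
  · push_cast
    rw [cosFourier_neg, cosFourierGamma_neg, cosFourier_natCast hs]

/-- The integral over a full period of the integrand twisted by a sign of matching parity. -/
lemma integral_sign_cos_mul_abs_cos_cpow {s : ℂ} (hs : 0 ≤ s.re) {ε : ℕ} {m : ℤ}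
    (hm : (-1 : ℂ) ^ ε = (-1) ^ m) :
    ∫ θ in (-Real.pi)..Real.pi, ((Real.sign (Real.cos θ) : ℝ) : ℂ) ^ ε *
      ((|Real.cos θ| : ℝ) : ℂ) ^ s * Complex.exp (-((m : ℂ) * (θ : ℂ)) * Complex.I) =
    2 * cosFourier s m := by
  have hpi := Real.pi_pos
  set f : ℝ → ℂ := fun θ => ((Real.sign (Real.cos θ) : ℝ) : ℂ) ^ ε *
      ((|Real.cos θ| : ℝ) : ℂ) ^ s * Complex.exp (-((m : ℂ) * (θ : ℂ)) * Complex.I) with hf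
  have hper : Function.Periodic f Real.pi := by
    intro θ
    have he : Complex.exp (-((m : ℂ) * ((θ + Real.pi : ℝ) : ℂ)) * Complex.I) =
        (-1) ^ m * Complex.exp (-((m : ℂ) * (θ : ℂ)) * Complex.I) := by
      rw [show -((m : ℂ) * ((θ + Real.pi : ℝ) : ℂ)) * Complex.I =
        (m : ℂ) * (-(Real.pi * Complex.I)) + -((m : ℂ) * (θ : ℂ)) * Complex.I by
          push_cast; ring, Complex.exp_add, Complex.exp_int_mul, Complex.exp_neg,
        Complex.exp_pi_mul_I]
      norm_num
    simp only [hf, he, Real.cos_add_pi, abs_neg, Real.sign_neg, Complex.ofReal_neg]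
    rw [neg_pow, hm]
    have : (-1 : ℂ) ^ m * (-1) ^ m = 1 := by
      rw [← mul_zpow]; norm_num
    linear_combination (((Real.sign (Real.cos θ) : ℝ) : ℂ) ^ ε *
      ((|Real.cos θ| : ℝ) : ℂ) ^ s * Complex.exp (-((m : ℂ) * (θ : ℂ)) * Complex.I)) * this
  have hEq : Set.EqOn (fun θ : ℝ => ((Real.cos θ : ℝ) : ℂ) ^ s *
      Complex.exp (-((m : ℂ) * (θ : ℂ)) * Complex.I)) f
      (Set.Ioo (-(Real.pi / 2)) (Real.pi / 2)) := by
    intro θ hθ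
    have hc := Real.cos_pos_of_mem_Ioo hθ
    simp [hf, Real.sign_of_pos hc, abs_of_pos hc]
  have hint := intervalIntegrable_cos_cpow_mul hs
    (g := fun θ : ℝ => Complex.exp (-((m : ℂ) * (θ : ℂ)) * Complex.I)) (by fun_prop)
  have hintf : IntervalIntegrable f volume (-(Real.pi / 2)) (Real.pi / 2) := by
    rw [intervalIntegrable_iff_integrableOn_Ioo_of_le (by linarith)] at hint ⊢
    exact hint.congr_fun hEq measurableSet_Ioo
  have hshift : -(Real.pi / 2) + Real.pi = Real.pi / 2 := by ring
  have hall := hper.intervalIntegrable hpi.ne' (t := -(Real.pi / 2)) (by rwa [hshift])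
  have h2 := hper.intervalIntegral_add_zsmul_eq 2 (-Real.pi) hall
  rw [show -Real.pi + (2 : ℤ) • Real.pi = Real.pi by rw [zsmul_eq_mul]; push_cast; ring,
    hper.intervalIntegral_add_eq (-Real.pi) (-(Real.pi / 2)), hshift, zsmul_eq_mul,
    ← intervalIntegral.integral_congr_Ioo_of_le (by linarith) hEq] at h2
  simpa [cosFourier] using h2

/-- for `ε ∈ {0,1}`, `μ ≡ ε (mod 2)`, `κ` even, and `η ∈ ℝ ∖ {0}`,
`(1/(2π))∫_{-π}^{π} sgn(cos θ)^ε |cos θ|^{-2iη} e^{-i(κ-μ)θ} dθ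
  = 2^{2iη} Γ(1-2iη)/(Γ(1-iη+(κ-μ)/2) Γ(1-iη-(κ-μ)/2))`. -/
theorem stmt_12 (ε : ℕ) (hε : ε = 0 ∨ ε = 1) (μ : ℤ) (hμ : μ % 2 = (ε : ℤ))
    (κ : ℤ) (hκ : Even κ) (η : ℝ) (hη : η ≠ 0) :
    ((1 / (2 * Real.pi) : ℝ) : ℂ) * ∫ θ in (-Real.pi)..Real.pi,
        ((Real.sign (Real.cos θ) : ℝ) : ℂ) ^ ε *
          ((|Real.cos θ| : ℝ) : ℂ) ^ (-2 * Complex.I * (η : ℂ)) *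
          Complex.exp (-(((κ : ℂ) - (μ : ℂ)) * (θ : ℂ)) * Complex.I)
      = (2 : ℂ) ^ (2 * Complex.I * (η : ℂ)) *
          Complex.Gamma (1 - 2 * Complex.I * (η : ℂ)) /
          (Complex.Gamma (1 - Complex.I * (η : ℂ) + ((κ : ℂ) - (μ : ℂ))/2) *
            Complex.Gamma (1 - Complex.I * (η : ℂ) - ((κ : ℂ) - (μ : ℂ))/2)) := by
  have hs : 0 ≤ (-2 * Complex.I * (η : ℂ)).re := by simp
  have hpar : (-1 : ℂ) ^ ε = (-1) ^ (κ - μ) := by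
    rw [← zpow_natCast, zpow_sub₀ (by norm_num), hκ.neg_one_zpow]
    rcases hε with rfl | rfl
    · have : Even μ := Int.even_iff.2 hμ
      simp [this.neg_one_zpow]
    · have : Odd μ := Int.odd_iff.2 hμ
      simp [this.neg_one_zpow]
  have h := integral_sign_cos_mul_abs_cos_cpow hs hpar
  rw [cosFourier_intCast hs] at h
  push_cast at h
  rw [h, cosFourierGamma]
  have hpi : (Real.pi : ℂ) ≠ 0 := by exact_mod_cast Real.pi_ne_zero
  rw [show 1 + -2 * Complex.I * (η : ℂ) = 1 - 2 * Complex.I * η by ring,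
    show -(-2 * Complex.I * (η : ℂ)) = 2 * Complex.I * η by ring,
    show 1 + -2 * Complex.I * (η : ℂ) / 2 = 1 - Complex.I * η by ring,
    div_eq_mul_inv _ (_ * _), mul_inv]
  push_cast
  field_simp
end
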